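/- arXiv:0906.4596 — 3 statements merged into one kernel-verified Lean document; each statement's English description precedes it below -/
import Mathlib

section
/- Let f : ℝ² → ℝ² be a homeomorphism with a fixed point p, admitting a Lyapunov metric function U that satisfies the both-signs condition and condition HP; assume f has no singularities and that every connected component of ℝ² \ (Wˢ(p) ∪ Wᵘ(p)) is f-invariant. If q ∈ ℝ² is such that Wᵘ(q) ∩ Wˢ(p) ≠ ∅, then Wˢ(q) ∩ Wᵘ(p) ≠ ∅; symmetrically, if Wˢ(q) ∩ Wᵘ(p) ≠ ∅, then Wᵘ(q) ∩ Wˢ(p) ≠ ∅. -/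
/-- First difference of `U` along the dynamics of `f`:
`V(x,y) = U(f(x),f(y)) − U(x,y)`. -/
def Vd (f : Equiv.Perm (ℝ × ℝ)) (U : ℝ × ℝ → ℝ × ℝ → ℝ) (x y : ℝ × ℝ) : ℝ :=
  U (f x) (f y) - U x y

/-- Second difference of `U` along the dynamics of `f`:
`W(x,y) = U(f²(x),f²(y)) − 2·U(f(x),f(y)) + U(x,y)`. -/
def Wd (f : Equiv.Perm (ℝ × ℝ)) (U : ℝ × ℝ → ℝ × ℝ → ℝ) (x y : ℝ × ℝ) : ℝ :=
  U (f (f x)) (f (f y)) - 2 * U (f x) (f y) + U x y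

/-- `U` is a Lyapunov metric function for `f`: a continuous metric on the plane
inducing the same topology as the Euclidean one, whose second difference along
`f` is strictly positive off the diagonal. -/
def IsLyapunovMetric (f : Equiv.Perm (ℝ × ℝ)) (U : ℝ × ℝ → ℝ × ℝ → ℝ) : Prop :=
  Continuous (fun z : (ℝ × ℝ) × (ℝ × ℝ) => U z.1 z.2) ∧
  (∀ x y, 0 ≤ U x y) ∧ (∀ x y, U x y = U y x) ∧
  (∀ x y, U x y = 0 ↔ x = y) ∧
  (∀ x y z, U x z ≤ U x y + U y z) ∧
  (∀ x : ℝ × ℝ, ∀ ε > (0:ℝ), ∃ δ > (0:ℝ), ∀ y, dist x y < δ → U x y < ε) ∧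
  (∀ x : ℝ × ℝ, ∀ ε > (0:ℝ), ∃ δ > (0:ℝ), ∀ y, U x y < δ → dist x y < ε) ∧
  (∀ x y : ℝ × ℝ, x ≠ y → 0 < Wd f U x y)

/-- `B_k(x)`: the connected component containing `x` of `{w : U(x,w) ≤ k}`. -/
def Bk (U : ℝ × ℝ → ℝ × ℝ → ℝ) (k : ℝ) (x : ℝ × ℝ) : Set (ℝ × ℝ) :=
  connectedComponentIn {w : ℝ × ℝ | U x w ≤ k} x

/-- The both-signs condition: on the boundary of every `B_k(x)` the first
difference takes both a positive and a negative value. -/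
def BothSigns (f : Equiv.Perm (ℝ × ℝ)) (U : ℝ × ℝ → ℝ × ℝ → ℝ) : Prop :=
  ∀ x : ℝ × ℝ, ∀ k > (0:ℝ),
    (∃ y ∈ frontier (Bk U k x), 0 < Vd f U x y) ∧
    (∃ z ∈ frontier (Bk U k x), Vd f U x z < 0)

/-- The `k`-stable set of `x`. -/
def Sk (f : Equiv.Perm (ℝ × ℝ)) (U : ℝ × ℝ → ℝ × ℝ → ℝ) (k : ℝ)
    (x : ℝ × ℝ) : Set (ℝ × ℝ) :=
  {y | ∀ n : ℤ, 0 ≤ n → U ((f ^ n) x) ((f ^ n) y) ≤ k}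

/-- The `k`-unstable set of `x`. -/
def Uk (f : Equiv.Perm (ℝ × ℝ)) (U : ℝ × ℝ → ℝ × ℝ → ℝ) (k : ℝ)
    (x : ℝ × ℝ) : Set (ℝ × ℝ) :=
  {y | ∀ n : ℤ, n ≤ 0 → U ((f ^ n) x) ((f ^ n) y) ≤ k}

/-- `C_k(x)`: the connected component of `S_k(x)` containing `x`. -/
def Ck (f : Equiv.Perm (ℝ × ℝ)) (U : ℝ × ℝ → ℝ × ℝ → ℝ) (k : ℝ)
    (x : ℝ × ℝ) : Set (ℝ × ℝ) :=
  connectedComponentIn (Sk f U k x) x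

/-- `D_k(x)`: the connected component of `U_k(x)` containing `x`. -/
def Dk (f : Equiv.Perm (ℝ × ℝ)) (U : ℝ × ℝ → ℝ × ℝ → ℝ) (k : ℝ)
    (x : ℝ × ℝ) : Set (ℝ × ℝ) :=
  connectedComponentIn (Uk f U k x) x

/-- The global stable set of `x`. -/
def Ws (f : Equiv.Perm (ℝ × ℝ)) (U : ℝ × ℝ → ℝ × ℝ → ℝ)
    (x : ℝ × ℝ) : Set (ℝ × ℝ) :=
  {y | ∃ K > (0:ℝ), ∀ n : ℤ, 0 ≤ n → U ((f ^ n) x) ((f ^ n) y) ≤ K}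

/-- The global unstable set of `x`. -/
def Wu (f : Equiv.Perm (ℝ × ℝ)) (U : ℝ × ℝ → ℝ × ℝ → ℝ)
    (x : ℝ × ℝ) : Set (ℝ × ℝ) :=
  {y | ∃ K > (0:ℝ), ∀ n : ℤ, n ≤ 0 → U ((f ^ n) x) ((f ^ n) y) ≤ K}

/-- Condition HP: for every compact set `C`, the quotient
`|V(x,y) − V(x,z)| / W(x,y)` tends to `0` as `‖x‖ → ∞`, uniformly in `y,z ∈ C`. -/
def CondHP (f : Equiv.Perm (ℝ × ℝ)) (U : ℝ × ℝ → ℝ × ℝ → ℝ) : Prop :=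
  ∀ C : Set (ℝ × ℝ), IsCompact C → ∀ ε > (0:ℝ), ∃ R > (0:ℝ),
    ∀ x : ℝ × ℝ, R < ‖x‖ → ∀ y ∈ C, ∀ z ∈ C,
      |Vd f U x y - Vd f U x z| / Wd f U x y < ε

/-- `p` has local product structure: there are a homeomorphism `h` of `ℝ²` onto
an open subset of `ℝ²` containing `p` and `k > 0` carrying vertical lines onto
local stable components and horizontal lines onto local unstable components. -/
def HasLocalProductStructure (f : Equiv.Perm (ℝ × ℝ))
    (U : ℝ × ℝ → ℝ × ℝ → ℝ) (p : ℝ × ℝ) : Prop :=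
  ∃ (h : ℝ × ℝ → ℝ × ℝ) (k : ℝ), 0 < k ∧
    Continuous h ∧ Function.Injective h ∧ IsOpenMap h ∧
    p ∈ Set.range h ∧
    ∀ a b : ℝ,
      h '' {q : ℝ × ℝ | q.1 = a} = Ck f U k (h (a, b)) ∩ Set.range h ∧
      h '' {q : ℝ × ℝ | q.2 = b} = Dk f U k (h (a, b)) ∩ Set.range h

/-- `f` has no singularities: every point has local product structure. -/
def NoSingularities (f : Equiv.Perm (ℝ × ℝ))
    (U : ℝ × ℝ → ℝ × ℝ → ℝ) : Prop :=
  ∀ p : ℝ × ℝ, HasLocalProductStructure f U p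

/-- Every connected component (quadrant) of the complement of
`Wˢ(p) ∪ Wᵘ(p)` is `f`-invariant. -/
def QuadrantsInvariant (f : Equiv.Perm (ℝ × ℝ))
    (U : ℝ × ℝ → ℝ × ℝ → ℝ) (p : ℝ × ℝ) : Prop :=
  ∀ q : ℝ × ℝ, q ∉ Ws f U p ∪ Wu f U p →
    (f : ℝ × ℝ → ℝ × ℝ) '' connectedComponentIn (Ws f U p ∪ Wu f U p)ᶜ q
      = connectedComponentIn (Ws f U p ∪ Wu f U p)ᶜ q

open Set Filter Topology

/-- A bounded convex sequence is nonincreasing. -/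
lemma convex_bdd_antitone (a : ℕ → ℝ) (K : ℝ) (hK : ∀ n, a n ≤ K)
    (hc : ∀ n, 0 ≤ a (n + 2) - 2 * a (n + 1) + a n) (n : ℕ) : a (n + 1) ≤ a n := by
  by_contra! hlt
  set d := a (n + 1) - a n with hd
  have hdpos : 0 < d := by linarith
  have h1 : ∀ m : ℕ, d ≤ a (n + m + 1) - a (n + m) := by
    intro m
    induction m with
    | zero => simp [hd]
    | succ m ih =>
      have := hc (n + m)
      have e : n + (m + 1) = n + m + 1 := by ring
      rw [e]
      linarith
  have h2 : ∀ m : ℕ, a n + m * d ≤ a (n + m) := by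
    intro m
    induction m with
    | zero => simp
    | succ m ih =>
      have := h1 m
      have e : n + (m + 1) = n + m + 1 := by ring
      rw [e]
      push_cast
      linarith
  obtain ⟨m, hm⟩ := exists_nat_gt ((K - a n) / d)
  rw [div_lt_iff₀ hdpos] at hm
  have := h2 m
  have := hK (n + m)
  linarith

lemma mem_Ws_iff (f : Equiv.Perm (ℝ × ℝ)) (U : ℝ × ℝ → ℝ × ℝ → ℝ)
    (hW : ∀ x y, 0 ≤ Wd f U x y) (x y : ℝ × ℝ) :
    y ∈ Ws f U x ↔ ∀ n : ℕ, U ((f ^ (n + 1)) x) ((f ^ (n + 1)) y) ≤ U ((f ^ n) x) ((f ^ n) y) := by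
  constructor
  · rintro ⟨K, -, hK⟩ n
    refine convex_bdd_antitone (fun n => U ((f ^ n) x) ((f ^ n) y)) K ?_ ?_ n
    · intro n
      simpa using hK n (by positivity)
    · intro n
      have := hW ((f ^ n) x) ((f ^ n) y)
      simpa only [Wd, pow_succ', Equiv.Perm.mul_apply] using this
  · intro h
    have h0 : ∀ n : ℕ, U ((f ^ n) x) ((f ^ n) y) ≤ U x y := by
      intro n
      induction n with
      | zero => simp
      | succ n ih => exact (h n).trans ih
    refine ⟨max 1 (U x y), by positivity, ?_⟩
    intro n hn
    obtain ⟨m, rfl⟩ := Int.eq_ofNat_of_zero_le hn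
    simpa using Or.inr (h0 m)

lemma Wu_eq (f : Equiv.Perm (ℝ × ℝ)) (U : ℝ × ℝ → ℝ × ℝ → ℝ) (x : ℝ × ℝ) :
    Wu f U x = Ws f⁻¹ U x := by
  ext y
  constructor
  · rintro ⟨K, h0, hK⟩
    exact ⟨K, h0, fun n hn => by simpa using hK (-n) (by omega)⟩
  · rintro ⟨K, h0, hK⟩
    exact ⟨K, h0, fun n hn => by simpa using hK (-n) (by omega)⟩

lemma isClosed_Ws (f : Equiv.Perm (ℝ × ℝ)) (U : ℝ × ℝ → ℝ × ℝ → ℝ) (hf : Continuous f)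
    (hUc : Continuous (fun z : (ℝ × ℝ) × (ℝ × ℝ) => U z.1 z.2))
    (hW : ∀ x y, 0 ≤ Wd f U x y) :
    IsClosed {z : (ℝ × ℝ) × (ℝ × ℝ) | z.2 ∈ Ws f U z.1} := by
  have hc : ∀ n : ℕ, Continuous (fun z : (ℝ × ℝ) × (ℝ × ℝ) => U ((f ^ n) z.1) ((f ^ n) z.2)) := by
    intro n
    have h1 : Continuous (f ^ n : Equiv.Perm (ℝ × ℝ)) := by
      rw [Equiv.Perm.coe_pow]; exact hf.iterate n
    exact hUc.comp ((h1.comp continuous_fst).prodMk (h1.comp continuous_snd))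
  simp only [mem_Ws_iff f U hW, ofPred_forall]
  exact isClosed_iInter fun n => isClosed_le (hc _) (hc _)

lemma Ws_trans (f : Equiv.Perm (ℝ × ℝ)) (U : ℝ × ℝ → ℝ × ℝ → ℝ)
    (htri : ∀ x y z, U x z ≤ U x y + U y z) {x y z : ℝ × ℝ}
    (h1 : y ∈ Ws f U x) (h2 : z ∈ Ws f U y) : z ∈ Ws f U x := by
  obtain ⟨K, hK, h1⟩ := h1
  obtain ⟨L, hL, h2⟩ := h2
  exact ⟨K + L, by positivity, fun n hn =>
    (htri _ _ _).trans (add_le_add (h1 n hn) (h2 n hn))⟩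

lemma Ws_symm (f : Equiv.Perm (ℝ × ℝ)) (U : ℝ × ℝ → ℝ × ℝ → ℝ)
    (hs : ∀ x y, U x y = U y x) {x y : ℝ × ℝ}
    (h1 : y ∈ Ws f U x) : x ∈ Ws f U y := by
  obtain ⟨K, hK, h1⟩ := h1
  exact ⟨K, hK, fun n hn => by rw [hs]; exact h1 n hn⟩

lemma Wu_map (f : Equiv.Perm (ℝ × ℝ)) (U : ℝ × ℝ → ℝ × ℝ → ℝ) {x y : ℝ × ℝ}
    (h : y ∈ Wu f U x) : f y ∈ Wu f U (f x) := by
  obtain ⟨K, hK, h⟩ := h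
  refine ⟨max K (U (f x) (f y)), lt_of_lt_of_le hK (le_max_left _ _), ?_⟩
  intro n hn
  rcases eq_or_lt_of_le hn with rfl | hn
  · simp
  · refine le_trans ?_ (le_max_left _ _)
    have := h (n + 1) (by omega)
    simpa only [zpow_add_one, Equiv.Perm.mul_apply] using this

section Rect

variable {X : Type*} [MetricSpace X] [ProperSpace X]

/-- Abstract form of what is used: two closed equivalence relations, transverse, with
bounded intersections of saturations of compacts, and local product charts. -/
structure Bifol (S T : X → X → Prop) : Prop where
  S_symm : ∀ {x y}, S x y → S y x
  T_symm : ∀ {x y}, T x y → T y x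
  S_trans : ∀ {x y z}, S x y → S y z → S x z
  T_trans : ∀ {x y z}, T x y → T y z → T x z
  S_refl : ∀ x, S x x
  T_refl : ∀ x, T x x
  S_closed : IsClosed {z : X × X | S z.1 z.2}
  T_closed : IsClosed {z : X × X | T z.1 z.2}
  sep : ∀ {x y}, S x y → T x y → x = y
  bdd : ∀ C : Set X, IsCompact C → Bornology.IsBounded {x | ∃ y ∈ C, ∃ z ∈ C, S x y ∧ T x z}
  chart : ∀ x : X, ∃ h : ℝ × ℝ → X, Continuous h ∧ IsOpen (range h) ∧ x ∈ range h ∧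
    (∀ a b b', S (h (a, b)) (h (a, b'))) ∧ (∀ a a' b, T (h (a, b)) (h (a', b)))

lemma Bifol.swap {S T : X → X → Prop} (B : Bifol S T) : Bifol T S where
  S_symm := B.T_symm
  T_symm := B.S_symm
  S_trans := B.T_trans
  T_trans := B.S_trans
  S_refl := B.T_refl
  T_refl := B.S_refl
  S_closed := B.T_closed
  T_closed := B.S_closed
  sep := fun h1 h2 => B.sep h2 h1
  bdd := fun C hC => (B.bdd C hC).subset (by
    rintro x ⟨y, hy, z, hz, h1, h2⟩
    exact ⟨z, hz, y, hy, h2, h1⟩)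
  chart := fun x => by
    obtain ⟨h, hc, ho, hx, h1, h2⟩ := B.chart x
    exact ⟨h ∘ Prod.swap, hc.comp continuous_swap, by
      rwa [Prod.swap_surjective.range_comp], by rwa [Prod.swap_surjective.range_comp],
      fun a b b' => h2 b b' a, fun a a' b => h1 b a a'⟩

open unitInterval

lemma Bifol.rect {S T : X → X → Prop} (B : Bifol S T) (α γ : I → X)
    (hα : Continuous α) (hγ : Continuous γ) (h0 : α 0 = γ 0)
    (hαS : ∀ s, S (α 0) (α s)) (hγT : ∀ t, T (γ 0) (γ t)) :
    ∃ x : I × I → X, Continuous x ∧ ∀ s t, T (α s) (x (s, t)) ∧ S (γ t) (x (s, t)) := by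
  set K : Set ((I × I) × X) := {z | T (α z.1.1) z.2 ∧ S (γ z.1.2) z.2} with hKdef
  have hKc : IsClosed K := by
    refine IsClosed.inter ?_ ?_
    · exact B.T_closed.preimage
        (f := fun z : (I × I) × X => (α z.1.1, z.2)) (by fun_prop)
    · exact B.S_closed.preimage
        (f := fun z : (I × I) × X => (γ z.1.2, z.2)) (by fun_prop)
  have hKcomp : IsCompact K := by
    have hC : IsCompact (range α ∪ range γ) :=
      (isCompact_range hα).union (isCompact_range hγ)
    have hb := (B.bdd _ hC).isCompact_closure
    refine (isCompact_univ.prod hb).of_isClosed_subset hKc ?_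
    rintro ⟨⟨s, t⟩, x⟩ ⟨h1, h2⟩
    exact ⟨trivial, subset_closure ⟨γ t, Or.inr ⟨t, rfl⟩, α s, Or.inl ⟨s, rfl⟩,
      B.S_symm h2, B.T_symm h1⟩⟩
  have huniq : ∀ i x y, (i, x) ∈ K → (i, y) ∈ K → x = y := by
    rintro i x y ⟨h1, h2⟩ ⟨h3, h4⟩
    exact B.sep (B.S_trans (B.S_symm h2) h4) (B.T_trans (B.T_symm h1) h3)
  set E : Set (I × I) := Prod.fst '' K with hE
  have hEc : IsClosed E := (hKcomp.image continuous_fst).isClosed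
  have hloc : ∀ i x, (i, x) ∈ K → ∀ O : Set X, IsOpen O → x ∈ O →
      ∀ᶠ j in 𝓝 i, ∀ y, (j, y) ∈ K → y ∈ O := by
    intro i x hx O hO hxO
    have hc : IsCompact (K ∩ Prod.snd ⁻¹' Oᶜ) :=
      hKcomp.inter_right (hO.isClosed_compl.preimage continuous_snd)
    have hcl : IsClosed (Prod.fst '' (K ∩ Prod.snd ⁻¹' Oᶜ)) :=
      (hc.image continuous_fst).isClosed
    have hni : i ∉ Prod.fst '' (K ∩ Prod.snd ⁻¹' Oᶜ) := by
      rintro ⟨⟨j, y⟩, ⟨hy, hyO⟩, rfl⟩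
      exact hyO (huniq _ _ _ hx hy ▸ hxO)
    filter_upwards [hcl.isOpen_compl.mem_nhds hni] with j hj y hy
    by_contra hyO
    exact hj ⟨(j, y), ⟨hy, hyO⟩, rfl⟩
  have hmem : ∀ {i}, i ∈ E → ∃ x, (i, x) ∈ K := by
    rintro i ⟨⟨j, y⟩, hy, rfl⟩
    exact ⟨y, hy⟩
  have hleft : ∀ s, (s, (0 : I)) ∈ E := fun s =>
    ⟨((s, 0), α s), ⟨B.T_refl _, by simpa [← h0] using hαS s⟩, rfl⟩
  have hbot : ∀ t, ((0 : I), t) ∈ E := fun t =>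
    ⟨((0, t), γ t), ⟨by simpa [h0] using hγT t, B.S_refl _⟩, rfl⟩
  -- the set of full columns is clopen
  have hcols : {s : I | ∀ t, (s, t) ∈ E} = univ := by
    refine IsClopen.eq_univ ⟨?_, ?_⟩ ⟨0, hbot⟩
    · rw [ofPred_forall]
      exact isClosed_iInter fun t => hEc.preimage (f := fun s : I => (s, t)) (by fun_prop)
    · rw [isOpen_iff_mem_nhds]
      intro s₀ hs₀
      have key : ∀ t₀ : I, ∃ O ∈ 𝓝 t₀, ∀ t₁ ∈ O, (∀ᶠ s in 𝓝 s₀, (s, t₁) ∈ E) →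
          ∀ᶠ s in 𝓝 s₀, ∀ t ∈ O, (s, t) ∈ E := by
        intro t₀
        obtain ⟨x₀, hx₀⟩ := hmem (hs₀ t₀)
        obtain ⟨h, hc, ho, hx, hS, hT⟩ := B.chart x₀
        have hev : ∀ᶠ t in 𝓝 t₀, ∀ y, ((s₀, t), y) ∈ K → y ∈ range h :=
          (Continuous.tendsto (f := fun t : I => (s₀, t)) (by fun_prop) t₀).eventually
            (hloc _ _ hx₀ _ ho hx)
        refine ⟨_, hev, ?_⟩
        intro t₁ ht₁ hN
        obtain ⟨x₁, hx₁⟩ := hmem (hs₀ t₁)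
        have hev1 : ∀ᶠ s in 𝓝 s₀, ∀ y, ((s, t₁), y) ∈ K → y ∈ range h :=
          (Continuous.tendsto (f := fun s : I => (s, t₁)) (by fun_prop) s₀).eventually
            (hloc _ _ hx₁ _ ho (ht₁ _ hx₁))
        filter_upwards [hN, hev1] with s hs1 hs2 t ht
        obtain ⟨y, hy⟩ := hmem hs1
        obtain ⟨y', hy'⟩ := hmem (hs₀ t)
        obtain ⟨⟨a, b⟩, rfl⟩ := hs2 _ hy
        obtain ⟨⟨a', b'⟩, rfl⟩ := ht _ hy'
        exact ⟨((s, t), h (a', b)), ⟨B.T_trans hy.1 (hT _ _ _),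
          B.S_trans hy'.2 (hS _ _ _)⟩, rfl⟩
      have hNuniv : {t : I | ∀ᶠ s in 𝓝 s₀, (s, t) ∈ E} = univ := by
        refine IsClopen.eq_univ ⟨?_, ?_⟩ ⟨0, Eventually.of_forall hleft⟩
        · rw [← closure_subset_iff_isClosed]
          intro t₀ ht₀
          obtain ⟨O, hO, hOk⟩ := key t₀
          obtain ⟨t₁, ht₁, hN⟩ := mem_closure_iff_nhds.1 ht₀ O hO
          exact (hOk t₁ ht₁ hN).mono fun s hs => hs t₀ (mem_of_mem_nhds hO)
        · rw [isOpen_iff_mem_nhds]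
          intro t₀ ht₀
          obtain ⟨O, hO, hOk⟩ := key t₀
          filter_upwards [hO] with t ht
          exact (hOk t₀ (mem_of_mem_nhds hO) ht₀).mono fun s hs => hs t ht
      have := isCompact_univ.eventually_forall_of_forall_eventually
        (K := (univ : Set I)) (x₀ := s₀) (P := fun s t => (s, t) ∈ E) (by
          intro t₀ _
          obtain ⟨O, hO, hOk⟩ := key t₀
          have h1 := hOk t₀ (mem_of_mem_nhds hO) (hNuniv.symm ▸ mem_univ t₀ :
            t₀ ∈ {t : I | ∀ᶠ s in 𝓝 s₀, (s, t) ∈ E})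
          filter_upwards [prod_mem_nhds h1 hO] with z hz
          exact hz.1 z.2 hz.2)
      filter_upwards [this] with s hs t
      exact hs t trivial
  have hall : ∀ i : I × I, ∃ x, (i, x) ∈ K := fun i =>
    hmem ((hcols.symm ▸ mem_univ i.1 : i.1 ∈ {s : I | ∀ t, (s, t) ∈ E}) i.2)
  choose x hx using hall
  refine ⟨x, ?_, fun s t => hx (s, t)⟩
  rw [continuous_iff_continuousAt]
  intro i O hO
  obtain ⟨O', hO'O, hO', hxO'⟩ := mem_nhds_iff.1 hO
  rw [mem_map]
  filter_upwards [hloc _ _ (hx i) O' hO' hxO'] with j hj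
  exact hO'O (hj _ (hx j))

/-- Rectangle completion in terms of joined points of leaves. -/
lemma Bifol.corner {S T : X → X → Prop} (B : Bifol S T) {c a b : X}
    (ha : JoinedIn {y | S c y} c a) (hb : JoinedIn {y | T c y} c b) :
    ∃ z, JoinedIn {y | T a y} a z ∧ JoinedIn {y | S b y} b z := by
  obtain ⟨α, hα⟩ := ha
  obtain ⟨γ, hγ⟩ := hb
  obtain ⟨x, hx, hxx⟩ := B.rect α γ α.continuous γ.continuous (by simp)
    (by simpa using hα) (by simpa using hγ)
  have e1 : x (1, 0) = a := by
    obtain ⟨h1, h2⟩ := hxx 1 0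
    have h3 := hα 1
    simp only [Path.target, Path.source, mem_ofPred_eq] at h1 h2 h3
    exact B.sep (B.S_trans (B.S_symm h2) h3) (B.T_symm h1)
  have e2 : x (0, 1) = b := by
    obtain ⟨h1, h2⟩ := hxx 0 1
    have h3 := hγ 1
    simp only [Path.target, Path.source, mem_ofPred_eq] at h1 h2 h3
    exact B.sep (B.S_symm h2) (B.T_trans (B.T_symm h1) h3)
  refine ⟨x (1, 1), ⟨⟨⟨fun t => x (1, t), by fun_prop⟩, e1, rfl⟩, fun t => ?_⟩,
    ⟨⟨⟨fun s => x (s, 1), by fun_prop⟩, e2, rfl⟩, fun s => ?_⟩⟩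
  · simpa using (hxx 1 t).1
  · simpa using (hxx s 1).2

lemma Bifol.joinS_symm {S T : X → X → Prop} (B : Bifol S T) {a b : X}
    (h : JoinedIn {y | S a y} a b) : JoinedIn {y | S b y} b a :=
  h.symm.mono fun _ hy => B.S_trans (B.S_symm h.target_mem) hy

lemma Bifol.joinS_trans {S T : X → X → Prop} (B : Bifol S T) {a b c : X}
    (h : JoinedIn {y | S a y} a b) (h' : JoinedIn {y | S b y} b c) :
    JoinedIn {y | S a y} a c :=
  h.trans (h'.mono fun _ hy => B.S_trans h.target_mem hy)

lemma Bifol.all [PreconnectedSpace X] {S T : X → X → Prop} (B : Bifol S T) (p q : X) :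
    ∃ b, T p b ∧ S b q := by
  set P : Set X := {x | ∃ b, JoinedIn {y | T p y} p b ∧ JoinedIn {y | S b y} b x} with hP
  have hSsat : ∀ x y, x ∈ P → JoinedIn {y | S x y} x y → y ∈ P := by
    rintro x y ⟨b, h1, h2⟩ h
    exact ⟨b, h1, B.joinS_trans h2 h⟩
  have hTsat : ∀ x y, x ∈ P → JoinedIn {y | T x y} x y → y ∈ P := by
    rintro x y ⟨b, h1, h2⟩ h
    obtain ⟨a, ha1, ha2⟩ := B.corner h2 (B.swap.joinS_symm h1)
    -- `ha1 : x → a` along `T`, `ha2 : p → a` along `S`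
    have h3 : JoinedIn {z | T a z} a y := B.swap.joinS_trans (B.swap.joinS_symm ha1) h
    obtain ⟨b', hb1, hb2⟩ := B.corner (B.joinS_symm ha2) h3
    exact ⟨b', hb1, B.joinS_symm hb2⟩
  have hchart : ∀ x, ∃ O ∈ 𝓝 x, ∀ y ∈ O, y ∈ P → O ⊆ P := by
    intro x
    obtain ⟨h, hc, ho, hx, hS, hT⟩ := B.chart x
    refine ⟨range h, ho.mem_nhds hx, ?_⟩
    rintro _ ⟨⟨a, b⟩, rfl⟩ hy _ ⟨⟨a', b'⟩, rfl⟩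
    have h1 : h (a, b') ∈ P := by
      refine hSsat _ _ hy ?_
      obtain ⟨γ⟩ := PathConnectedSpace.joined b b'
      exact ⟨γ.map (f := fun t : ℝ => h (a, t)) (by fun_prop), fun t => hS a b (γ t)⟩
    refine hTsat _ _ h1 ?_
    obtain ⟨γ⟩ := PathConnectedSpace.joined a a'
    exact ⟨γ.map (f := fun t : ℝ => h (t, b')) (by fun_prop), fun t => hT a (γ t) b'⟩
  have hPu : P = univ := by
    refine IsClopen.eq_univ ⟨?_, ?_⟩ ⟨p, p, JoinedIn.refl (B.T_refl p), JoinedIn.refl (B.S_refl p)⟩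
    · rw [← closure_subset_iff_isClosed]
      intro x hx
      obtain ⟨O, hO, hOk⟩ := hchart x
      obtain ⟨y, hy, hyP⟩ := mem_closure_iff_nhds.1 hx O hO
      exact hOk y hy hyP (mem_of_mem_nhds hO)
    · rw [isOpen_iff_mem_nhds]
      intro x hx
      obtain ⟨O, hO, hOk⟩ := hchart x
      exact mem_of_superset hO (hOk x (mem_of_mem_nhds hO) hx)
  obtain ⟨b, h1, h2⟩ : q ∈ P := hPu ▸ mem_univ q
  exact ⟨b, h1.target_mem, h2.target_mem⟩

end Rect

lemma bifol_of_lyapunov (f : Equiv.Perm (ℝ × ℝ)) (hf : Continuous f) (hf' : Continuous f.symm)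
    (U : ℝ × ℝ → ℝ × ℝ → ℝ) (hU : IsLyapunovMetric f U)
    (hHP : CondHP f U) (hNS : NoSingularities f U) :
    Bifol (fun x y => y ∈ Ws f U x) (fun x y => y ∈ Wu f U x) := by
  obtain ⟨hUc, hnn, hsym, hzero, htri, -, -, hWpos⟩ := hU
  have hself : ∀ x, U x x = 0 := fun x => (hzero x x).2 rfl
  have hW : ∀ x y, 0 ≤ Wd f U x y := by
    intro x y
    by_cases h : x = y
    · subst h; simp [Wd, hself]
    · exact (hWpos x y h).le
  have hW' : ∀ x y, 0 ≤ Wd f⁻¹ U x y := by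
    intro x y
    have := hW (f⁻¹ (f⁻¹ x)) (f⁻¹ (f⁻¹ y))
    have hi : ∀ w, f (f⁻¹ w) = w := fun w => f.apply_symm_apply w
    simp only [Wd, hi] at this ⊢
    linarith
  have hSV : ∀ x y, y ∈ Ws f U x → U (f (f x)) (f (f y)) ≤ U (f x) (f y) := by
    intro x y h
    simpa [pow_succ'] using (mem_Ws_iff f U hW x y).1 h 1
  have hTV : ∀ x y, y ∈ Wu f U x → U x y ≤ U (f x) (f y) := by
    intro x y h
    have h1 := Wu_map f U h
    rw [Wu_eq] at h1
    simpa using (mem_Ws_iff f⁻¹ U hW' _ _).1 h1 0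
  constructor
  · exact fun h => Ws_symm f U hsym h
  · intro x y h
    rw [Wu_eq] at h ⊢
    exact Ws_symm f⁻¹ U hsym h
  · exact fun h h' => Ws_trans f U htri h h'
  · intro x y z h h'
    rw [Wu_eq] at h h' ⊢
    exact Ws_trans f⁻¹ U htri h h'
  · exact fun x => ⟨1, one_pos, fun n _ => by rw [hself]; exact zero_le_one⟩
  · exact fun x => ⟨1, one_pos, fun n _ => by rw [hself]; exact zero_le_one⟩
  · exact isClosed_Ws f U hf hUc hW
  · simp only [Wu_eq]
    exact isClosed_Ws f⁻¹ U hf' hUc hW'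
  · intro x y hS hT
    by_contra hne
    have h1 := hSV x y hS
    have h2 := hTV x y hT
    have h3 := hWpos x y hne
    have h4 := hTV _ _ (Wu_map f U hT)
    have h5 := (mem_Ws_iff f U hW x y).1 hS 0
    simp at h5
    simp only [Wd] at h3
    linarith
  · intro C hC
    obtain ⟨R, hR, hHP⟩ := hHP C hC 1 one_pos
    refine (Metric.isBounded_closedBall (x := (0 : ℝ × ℝ)) (r := R)).union hC.isBounded |>.subset ?_
    rintro x ⟨y, hy, z, hz, hS, hT⟩
    by_cases hxy : x = y
    · exact Or.inr (hxy ▸ hy)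
    left
    rw [mem_closedBall_zero_iff]
    by_contra! hlt
    have h1 := hHP x hlt y hy z hz
    have h2 := hWpos x y hxy
    rw [div_lt_one h2] at h1
    have h3 := hSV x y hS
    have h4 := hTV x z hT
    have h5 := neg_abs_le (Vd f U x y - Vd f U x z)
    simp only [Vd, Wd] at *
    linarith
  · intro x
    obtain ⟨h, k, hk, hc, -, ho, hx, hh⟩ := hNS x
    refine ⟨h, hc, ho.isOpen_range, hx, ?_, ?_⟩
    · intro a b b'
      have : h (a, b') ∈ Ck f U k (h (a, b)) ∩ range h :=
        (hh a b).1 ▸ ⟨(a, b'), rfl, rfl⟩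
      exact ⟨k, hk, connectedComponentIn_subset _ _ this.1⟩
    · intro a a' b
      have : h (a', b) ∈ Dk f U k (h (a, b)) ∩ range h :=
        (hh a b).2 ▸ ⟨(a', b), rfl, rfl⟩
      exact ⟨k, hk, connectedComponentIn_subset _ _ this.1⟩

/-- if the unstable (resp. stable) set of a point intersects the
stable (resp. unstable) set of the fixed point, then the stable (resp.
unstable) set of that point intersects the unstable (resp. stable) set of the
fixed point. -/
theorem stable_meets_unstable_of_fixed_point_swap
    (f : Equiv.Perm (ℝ × ℝ)) (hf : Continuous f) (hf' : Continuous f.symm)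
    (p : ℝ × ℝ) (hfix : f p = p)
    (U : ℝ × ℝ → ℝ × ℝ → ℝ) (hU : IsLyapunovMetric f U)
    (hBS : BothSigns f U) (hHP : CondHP f U)
    (hNS : NoSingularities f U) (hQI : QuadrantsInvariant f U p) :
    ∀ q : ℝ × ℝ,
      ((Wu f U q ∩ Ws f U p).Nonempty → (Ws f U q ∩ Wu f U p).Nonempty) ∧
      ((Ws f U q ∩ Wu f U p).Nonempty → (Wu f U q ∩ Ws f U p).Nonempty) := by
  intro q
  have B := bifol_of_lyapunov f hf hf' U hU hHP hNS
  obtain ⟨b, hb1, hb2⟩ := B.all p q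
  obtain ⟨a, ha1, ha2⟩ := B.swap.all p q
  exact ⟨fun _ => ⟨b, B.S_symm hb2, hb1⟩, fun _ => ⟨a, B.T_symm ha2, ha1⟩⟩
end

section
/- Let f : ℝ² → ℝ² be a homeomorphism with a fixed point p, admitting a Lyapunov metric function U that satisfies the both-signs condition and condition HP; assume f has no singularities and that every connected component of ℝ² \ (Wˢ(p) ∪ Wᵘ(p)) is f-invariant. Then for every q ∈ ℝ², the stable set of q intersects the unstable set of the fixed point and the unstable set of q intersects the stable set of the fixed point: Wˢ(q) ∩ Wᵘ(p) ≠ ∅ and Wᵘ(q) ∩ Wˢ(p) ≠ ∅. -/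
open Set Filter Topology

namespace LPS

structure Sys (S T : ℝ × ℝ → ℝ × ℝ → Prop) : Prop where
  eS : Equivalence S
  eT : Equivalence T
  uniq : ∀ x y, S x y → T x y → x = y
  chart : ∀ p : ℝ × ℝ, ∃ h : ℝ × ℝ → ℝ × ℝ, Continuous h ∧ IsOpenMap h ∧ p ∈ range h ∧
    (∀ a b b', S (h (a, b)) (h (a, b'))) ∧ (∀ a a' b, T (h (a, b)) (h (a', b)))

theorem Sys.swap {S T : ℝ × ℝ → ℝ × ℝ → Prop} (H : Sys S T) : Sys T S where
  eS := H.eT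
  eT := H.eS
  uniq := fun x y h1 h2 => H.uniq x y h2 h1
  chart := by
    intro p
    obtain ⟨h, hc, ho, ⟨x, hx⟩, h1, h2⟩ := H.chart p
    refine ⟨h ∘ Prod.swap, hc.comp continuous_swap,
      ho.comp (Homeomorph.prodComm ℝ ℝ).isOpenMap, ⟨x.swap, by simpa using hx⟩, ?_, ?_⟩
    · intro a b b'; exact h2 b b' a
    · intro a a' b; exact h1 b a a'

def Lf (S : ℝ × ℝ → ℝ × ℝ → Prop) (a c : ℝ × ℝ) : Prop := JoinedIn {x | S a x} a c

theorem Lf.rel {S : ℝ × ℝ → ℝ × ℝ → Prop} {a c : ℝ × ℝ} (h : Lf S a c) : S a c :=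
  h.target_mem

theorem setEq {S : ℝ × ℝ → ℝ × ℝ → Prop} (e : Equivalence S) {a c : ℝ × ℝ} (h : S a c) :
    {x | S a x} = {x | S c x} := by
  ext x
  exact ⟨fun k => e.trans (e.symm h) k, fun k => e.trans h k⟩

theorem Lf.symm {S : ℝ × ℝ → ℝ × ℝ → Prop} (e : Equivalence S) {a c : ℝ × ℝ} (h : Lf S a c) :
    Lf S c a := by
  unfold Lf
  rw [← setEq e h.rel]
  exact JoinedIn.symm h

theorem Lf.trans {S : ℝ × ℝ → ℝ × ℝ → Prop} (e : Equivalence S) {a b c : ℝ × ℝ}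
    (h : Lf S a b) (k : Lf S b c) : Lf S a c := by
  unfold Lf at k
  rw [← setEq e h.rel] at k
  exact JoinedIn.trans h k

theorem Lf.refl {S : ℝ × ℝ → ℝ × ℝ → Prop} (e : Equivalence S) (a : ℝ × ℝ) : Lf S a a :=
  JoinedIn.refl (e.refl a)

theorem plaque {S : ℝ × ℝ → ℝ × ℝ → Prop} {h : ℝ × ℝ → ℝ × ℝ} (hc : Continuous h)
    (h1 : ∀ a b b', S (h (a, b)) (h (a, b'))) (a b b' : ℝ) :
    Lf S (h (a, b)) (h (a, b')) := by
  refine ⟨⟨⟨fun s => h (a, b + (s : ℝ) * (b' - b)), by fun_prop⟩, by simp, by simp⟩, ?_⟩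
  intro t
  exact h1 _ _ _

theorem samePlaque {S T : ℝ × ℝ → ℝ × ℝ → Prop} (H : Sys S T)
    {h : ℝ × ℝ → ℝ × ℝ}
    (h1 : ∀ a b b', S (h (a, b)) (h (a, b'))) (h2 : ∀ a a' b, T (h (a, b)) (h (a', b)))
    {a b a' b' : ℝ} (hS : S (h (a, b)) (h (a', b'))) : h (a, b') = h (a', b') :=
  H.uniq _ _ (H.eS.trans (H.eS.symm (h1 a b b')) hS) (h2 a a' b')

theorem near {S T : ℝ × ℝ → ℝ × ℝ → Prop} (H : Sys S T) (c : ℝ × ℝ) :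
    ∃ O, IsOpen O ∧ c ∈ O ∧ ∀ x ∈ O, S c x → Lf S c x := by
  obtain ⟨h, hc, ho, ⟨⟨a, b⟩, rfl⟩, h1, h2⟩ := H.chart c
  refine ⟨range h, ho.isOpen_range, ⟨_, rfl⟩, ?_⟩
  rintro _ ⟨⟨a', b'⟩, rfl⟩ hS
  rw [← samePlaque H h1 h2 hS]
  exact plaque hc h1 a b b'

theorem satOpen {S T : ℝ × ℝ → ℝ × ℝ → Prop} (H : Sys S T) {O : Set (ℝ × ℝ)} (hO : IsOpen O) :
    IsOpen {a | ∃ c ∈ O, Lf S a c} := by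
  set A := {a | ∃ c ∈ O, Lf S a c} with hA
  have hOA : O ⊆ interior A :=
    interior_maximal (fun x hx => ⟨x, hx, Lf.refl H.eS x⟩) hO
  rw [← subset_interior_iff_isOpen]
  rintro a ⟨c, hcO, γ, hγ⟩
  have key : IsClopen (γ ⁻¹' interior A) := by
    refine ⟨?_, isOpen_interior.preimage γ.continuous⟩
    rw [← closure_subset_iff_isClosed]
    intro t ht
    obtain ⟨h, hc, ho, ⟨⟨x, y⟩, hxy⟩, h1, h2⟩ := H.chart (γ t)
    rw [mem_closure_iff] at ht
    obtain ⟨t', ht'1, ht'2⟩ := ht (γ ⁻¹' range h) (ho.isOpen_range.preimage γ.continuous)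
      ⟨_, hxy⟩
    obtain ⟨⟨x', y'⟩, hxy'⟩ := ht'1
    have hS : S (h (x, y)) (h (x', y')) := by
      rw [hxy, hxy']; exact H.eS.trans (H.eS.symm (hγ t)) (hγ t')
    have e := samePlaque H h1 h2 hS
    have hin : h (x, y') ∈ interior A := by rw [e, hxy']; exact ht'2
    let G : Set ℝ := (fun u => h (u, y')) ⁻¹' interior A
    have hG : IsOpen G := isOpen_interior.preimage (by fun_prop)
    have hsub : h '' (G ×ˢ univ) ⊆ A := by
      rintro _ ⟨⟨u, v⟩, ⟨hu, -⟩, rfl⟩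
      obtain ⟨c, hc1, hc2⟩ := interior_subset hu
      exact ⟨c, hc1, (plaque hc h1 u v y').trans H.eS hc2⟩
    change γ t ∈ interior A
    exact interior_maximal hsub (ho _ (hG.prod isOpen_univ)) ⟨(x, y), ⟨hin, mem_univ _⟩, hxy⟩
  have := key.eq_univ ⟨1, by simpa using hOA hcO⟩
  have h0 : (0 : unitInterval) ∈ γ ⁻¹' interior A := by rw [this]; trivial
  simpa using h0

def Om (S T : ℝ × ℝ → ℝ × ℝ → Prop) (a b : ℝ × ℝ) : Prop := ∃ c, Lf S a c ∧ Lf T b c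

theorem omOpen {S T : ℝ × ℝ → ℝ × ℝ → Prop} (H : Sys S T) :
    IsOpen {z : (ℝ × ℝ) × (ℝ × ℝ) | Om S T z.1 z.2} := by
  rw [isOpen_iff_mem_nhds]
  rintro ⟨a, b⟩ ⟨c, hac, hbc⟩
  obtain ⟨h, hc, ho, hr, h1, h2⟩ := H.chart c
  have o1 := satOpen H ho.isOpen_range
  have o2 := satOpen H.swap ho.isOpen_range
  filter_upwards [prod_mem_nhds (o1.mem_nhds ⟨c, hr, hac⟩) (o2.mem_nhds ⟨c, hr, hbc⟩)]
  rintro ⟨a', b'⟩ ⟨⟨_, ⟨⟨x, y⟩, rfl⟩, k1⟩, ⟨_, ⟨⟨x', y'⟩, rfl⟩, k2⟩⟩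
  refine ⟨h (x, y'), k1.trans H.eS (plaque hc h1 _ _ _), k2.trans H.eT ?_⟩
  exact plaque (h := fun z => h z.swap) (hc.comp continuous_swap)
    (fun a b b' => h2 b b' a) y' x' x

theorem limBracket {S T : ℝ × ℝ → ℝ × ℝ → Prop}
    (cS : IsClosed {z : (ℝ × ℝ) × (ℝ × ℝ) | S z.1 z.2})
    (cT : IsClosed {z : (ℝ × ℝ) × (ℝ × ℝ) | T z.1 z.2})
    (bdd : ∀ C : Set (ℝ × ℝ), IsCompact C → ∃ K : Set (ℝ × ℝ), IsCompact K ∧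
      ∀ y ∈ C, ∀ z ∈ C, ∀ x, S y x → T z x → x ∈ K)
    {C : Set (ℝ × ℝ)} (hC : IsCompact C) {y z x : ℕ → ℝ × ℝ} {y0 z0 : ℝ × ℝ}
    (hy : ∀ n, y n ∈ C) (hz : ∀ n, z n ∈ C) (ly : Tendsto y atTop (𝓝 y0))
    (lz : Tendsto z atTop (𝓝 z0)) (hS : ∀ n, S (y n) (x n)) (hT : ∀ n, T (z n) (x n)) :
    ∃ c, S y0 c ∧ T z0 c ∧ ∀ O, IsOpen O → c ∈ O → ∃ n, x n ∈ O := by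
  obtain ⟨K, hK, hb⟩ := bdd C hC
  obtain ⟨c, -, φ, hφ, hl⟩ := hK.tendsto_subseq
    (fun n => hb _ (hy n) _ (hz n) _ (hS n) (hT n))
  refine ⟨c, ?_, ?_, ?_⟩
  · exact cS.mem_of_tendsto ((ly.comp hφ.tendsto_atTop).prodMk_nhds hl)
      (Eventually.of_forall fun n => hS (φ n))
  · exact cT.mem_of_tendsto ((lz.comp hφ.tendsto_atTop).prodMk_nhds hl)
      (Eventually.of_forall fun n => hT (φ n))
  · intro O hO hc
    obtain ⟨n, hn⟩ := (hl.eventually (hO.mem_nhds hc)).exists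
    exact ⟨φ n, hn⟩

theorem exSeq {t : unitInterval} (ht : t ≠ 0) :
    ∃ u : ℕ → unitInterval, (∀ n, u n < t) ∧ Tendsto u atTop (𝓝 t) := by
  have h0 : 0 < t := unitInterval.pos_iff_ne_zero.2 ht
  have : (𝓝[<] t).NeBot := nhdsLT_neBot_of_exists_lt ⟨0, h0⟩
  obtain ⟨u, hu⟩ := exists_seq_tendsto (𝓝[<] t)
  rw [tendsto_nhdsWithin_iff] at hu
  obtain ⟨N, hN⟩ := eventually_atTop.1 hu.2
  exact ⟨fun n => u (n + N), fun n => hN _ (Nat.le_add_left _ _),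
    hu.1.comp (tendsto_add_atTop_nat N)⟩

theorem square (P : unitInterval × unitInterval → Prop) (hP : IsOpen {z | P z})
    (h0 : ∀ t, P (t, 0)) (h1 : ∀ s, P (0, s))
    (hc : ∀ t s, t ≠ 0 → s ≠ 0 → (∀ t' < t, P (t', s)) → (∀ s' < s, P (t, s')) → P (t, s)) :
    ∀ z, P z := by
  by_contra hcon
  push Not at hcon
  have hF : IsCompact {z | P z}ᶜ := hP.isClosed_compl.isCompact
  obtain ⟨⟨t, s⟩, hz, hmin⟩ := hF.exists_isMinOn (f := fun z => (z.1 : ℝ) + (z.2 : ℝ)) hcon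
    (by fun_prop)
  apply hz
  apply hc
  · rintro rfl; exact hz (h1 s)
  · rintro rfl; exact hz (h0 t)
  · intro t' ht'
    by_contra hn
    have := hmin (show (t', s) ∈ {z | P z}ᶜ from hn)
    have h2 : (t' : ℝ) < t := ht'
    simp only [mem_ofPred_eq] at this
    linarith
  · intro s' hs'
    by_contra hn
    have := hmin (show (t, s') ∈ {z | P z}ᶜ from hn)
    have h2 : (s' : ℝ) < s := hs'
    simp only [mem_ofPred_eq] at this
    linarith

theorem main {S T : ℝ × ℝ → ℝ × ℝ → Prop} (H : Sys S T)
    (cS : IsClosed {z : (ℝ × ℝ) × (ℝ × ℝ) | S z.1 z.2})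
    (cT : IsClosed {z : (ℝ × ℝ) × (ℝ × ℝ) | T z.1 z.2})
    (bdd : ∀ C : Set (ℝ × ℝ), IsCompact C → ∃ K : Set (ℝ × ℝ), IsCompact K ∧
      ∀ y ∈ C, ∀ z ∈ C, ∀ x, S y x → T z x → x ∈ K) (a b : ℝ × ℝ) : Om S T a b := by
  have key : IsClopen {a | Om S T a b} := by
    refine ⟨?_, (omOpen H).preimage (f := fun a => (a, b)) (by fun_prop)⟩
    rw [← closure_subset_iff_isClosed]
    intro a ha
    obtain ⟨h, hc, ho, hr, h1, h2⟩ := H.chart a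
    rw [mem_closure_iff] at ha
    obtain ⟨_, ⟨⟨x', y'⟩, rfl⟩, c, k1, k2⟩ := ha _ ho.isOpen_range hr
    obtain ⟨⟨x, y⟩, rfl⟩ := hr
    have k1' : Lf S (h (x', y)) c := (plaque hc h1 _ _ _).trans H.eS k1
    have k3 : Lf T (h (x', y)) (h (x, y)) :=
      plaque (h := fun z => h z.swap) (hc.comp continuous_swap)
        (fun a b b' => h2 b b' a) y x' x
    obtain ⟨α, hα⟩ := k1'
    obtain ⟨q, hq⟩ := k3
    have lα : ∀ s, Lf S (h (x', y)) (α s) := fun s => by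
      refine ⟨(α.truncateOfLE (t₀ := 0) (t₁ := s) s.2.1).cast (by simp) (by simp), ?_⟩
      intro t
      have := Path.truncate_range α (t₀ := 0) (t₁ := (s : ℝ)) ⟨t, rfl⟩
      obtain ⟨w, hw⟩ := this
      have e := hα w
      rw [hw] at e
      exact e
    have lq : ∀ s, Lf T (h (x', y)) (q s) := fun s => by
      refine ⟨(q.truncateOfLE (t₀ := 0) (t₁ := s) s.2.1).cast (by simp) (by simp), ?_⟩
      intro t
      have := Path.truncate_range q (t₀ := 0) (t₁ := (s : ℝ)) ⟨t, rfl⟩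
      obtain ⟨w, hw⟩ := this
      have e := hq w
      rw [hw] at e
      exact e
    have hC : IsCompact (range q ∪ range α) :=
      (isCompact_range q.continuous).union (isCompact_range α.continuous)
    have sq := square (fun z => Om S T (q z.1) (α z.2))
      ((omOpen H).preimage (f := fun z : unitInterval × unitInterval => (q z.1, α z.2))
        (by fun_prop))
      (fun t => ⟨q t, Lf.refl H.eS _, by simpa using lq t⟩)
      (fun s => ⟨α s, by simpa using lα s, Lf.refl H.eT _⟩) (by
        intro t s ht hs ih1 ih2
        obtain ⟨u, hu, lu⟩ := exSeq ht
        obtain ⟨v, hv, lv⟩ := exSeq hs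
        choose c1 hc1 using fun n => ih1 (u n) (hu n)
        choose c2 hc2 using fun n => ih2 (v n) (hv n)
        obtain ⟨d, hd1, hd2, hd3⟩ := limBracket cS cT bdd hC (y := fun n => q (u n))
          (z := fun n => α s) (x := c1) (fun n => Or.inl ⟨_, rfl⟩) (fun n => Or.inr ⟨_, rfl⟩)
          ((q.continuous.tendsto t).comp lu) tendsto_const_nhds
          (fun n => (hc1 n).1.rel) (fun n => (hc1 n).2.rel)
        obtain ⟨d', hd1', hd2', hd3'⟩ := limBracket cS cT bdd hC (y := fun n => q t)
          (z := fun n => α (v n)) (x := c2) (fun n => Or.inl ⟨_, rfl⟩) (fun n => Or.inr ⟨_, rfl⟩)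
          tendsto_const_nhds ((α.continuous.tendsto s).comp lv)
          (fun n => (hc2 n).1.rel) (fun n => (hc2 n).2.rel)
        obtain rfl : d = d' := H.uniq _ _ (H.eS.trans (H.eS.symm hd1) hd1')
          (H.eT.trans (H.eT.symm hd2) hd2')
        obtain ⟨O, o1, o2, o3⟩ := near H d
        obtain ⟨O', o1', o2', o3'⟩ := near H.swap d
        obtain ⟨n, hn⟩ := hd3 O' o1' o2'
        obtain ⟨m, hm⟩ := hd3' O o1 o2
        refine ⟨d, (hc2 m).1.trans H.eS ?_, (hc1 n).2.trans H.eT ?_⟩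
        · exact (o3 _ hm (H.eS.trans (H.eS.symm hd1) (hc2 m).1.rel)).symm H.eS
        · exact (o3' _ hn (H.eT.trans (H.eT.symm hd2) (hc1 n).2.rel)).symm H.eT)
    obtain ⟨d, e1, e2⟩ := sq (1, 1)
    simp only [Path.target] at e1 e2
    exact ⟨d, e1, k2.trans H.eT e2⟩
  have := key.eq_univ ⟨b, b, Lf.refl H.eS b, Lf.refl H.eT b⟩
  have h0 : a ∈ {a | Om S T a b} := by rw [this]; trivial
  exact h0

theorem antitone_of_bdd (u : ℕ → ℝ) (K : ℝ) (hK : ∀ n, u n ≤ K)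
    (hc : ∀ n, 0 ≤ u (n + 2) - 2 * u (n + 1) + u n) : ∀ n, u (n + 1) ≤ u n := by
  intro n
  by_contra hlt
  push Not at hlt
  have hd : ∀ m, u (n + 1) - u n ≤ u (n + m + 1) - u (n + m) := by
    intro m
    induction m with
    | zero => simp
    | succ m ih =>
      have := hc (n + m)
      rw [show n + (m + 1) + 1 = n + m + 2 by ring, show n + (m + 1) = n + m + 1 by ring]
      linarith
  have hs : ∀ m : ℕ, u n + m * (u (n + 1) - u n) ≤ u (n + m) := by
    intro m
    induction m with
    | zero => simp
    | succ m ih =>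
      have := hd m
      rw [show n + (m + 1) = n + m + 1 by ring]
      push_cast
      linarith
  obtain ⟨m, hm⟩ := exists_nat_gt ((K - u n) / (u (n + 1) - u n))
  rw [div_lt_iff₀ (by linarith)] at hm
  linarith [hs m, hK (n + m)]

section dyn
variable {f : Equiv.Perm (ℝ × ℝ)} {U : ℝ × ℝ → ℝ × ℝ → ℝ}

theorem convZ (hW : ∀ x y : ℝ × ℝ, 0 ≤ Wd f U x y) (x y : ℝ × ℝ) (n : ℤ) :
    0 ≤ U ((f ^ (n + 2)) x) ((f ^ (n + 2)) y) - 2 * U ((f ^ (n + 1)) x) ((f ^ (n + 1)) y)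
      + U ((f ^ n) x) ((f ^ n) y) := by
  have h1 : ∀ z, (f ^ (n + 1)) z = f ((f ^ n) z) := fun z => by
    rw [add_comm, zpow_add, zpow_one]; rfl
  have h2 : ∀ z, (f ^ (n + 2)) z = f (f ((f ^ n) z)) := fun z => by
    rw [add_comm, zpow_add]; rfl
  have := hW ((f ^ n) x) ((f ^ n) y)
  unfold Wd at this
  rw [h1, h1, h2, h2]
  exact this

theorem ws_anti (hW : ∀ x y : ℝ × ℝ, 0 ≤ Wd f U x y) {x y : ℝ × ℝ} (h : y ∈ Ws f U x) (n : ℕ) :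
    U ((f ^ ((n : ℤ) + 1)) x) ((f ^ ((n : ℤ) + 1)) y) ≤ U ((f ^ (n : ℤ)) x) ((f ^ (n : ℤ)) y) := by
  obtain ⟨K, -, hK⟩ := h
  have := antitone_of_bdd (fun n : ℕ => U ((f ^ (n : ℤ)) x) ((f ^ (n : ℤ)) y)) K
    (fun n => hK n (by positivity)) (fun n => by
      have := convZ hW x y n
      push_cast
      exact this) n
  push_cast at this
  exact this

theorem wu_anti (hW : ∀ x y : ℝ × ℝ, 0 ≤ Wd f U x y) {x y : ℝ × ℝ} (h : y ∈ Wu f U x) (n : ℕ) :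
    U ((f ^ (-(n : ℤ) - 1)) x) ((f ^ (-(n : ℤ) - 1)) y)
      ≤ U ((f ^ (-(n : ℤ))) x) ((f ^ (-(n : ℤ))) y) := by
  obtain ⟨K, -, hK⟩ := h
  have := antitone_of_bdd (fun n : ℕ => U ((f ^ (-(n : ℤ))) x) ((f ^ (-(n : ℤ))) y)) K
    (fun n => hK _ (by simp)) (fun n => by
      have := convZ hW x y (-(n : ℤ) - 2)
      rw [show -(n : ℤ) - 2 + 2 = -n by ring, show -(n : ℤ) - 2 + 1 = -n - 1 by ring] at this
      push_cast
      rw [show -((n : ℤ) + 2) = -n - 2 by ring, show -((n : ℤ) + 1) = -n - 1 by ring]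
      linarith) n
  push_cast at this
  rw [show -((n : ℤ) + 1) = -n - 1 by ring] at this
  exact this

theorem ws_iff (hW : ∀ x y : ℝ × ℝ, 0 ≤ Wd f U x y) (h0 : ∀ x y, 0 ≤ U x y) (x y : ℝ × ℝ) :
    y ∈ Ws f U x ↔ ∀ n : ℕ, U ((f ^ (n : ℤ)) x) ((f ^ (n : ℤ)) y) ≤ U x y := by
  constructor
  · intro h n
    induction n with
    | zero => simp
    | succ n ih =>
      push_cast
      exact (ws_anti hW h n).trans ih
  · intro h
    refine ⟨U x y + 1, by linarith [h0 x y], fun n hn => ?_⟩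
    lift n to ℕ using hn
    linarith [h n]

theorem wu_iff (hW : ∀ x y : ℝ × ℝ, 0 ≤ Wd f U x y) (h0 : ∀ x y, 0 ≤ U x y) (x y : ℝ × ℝ) :
    y ∈ Wu f U x ↔ ∀ n : ℕ, U ((f ^ (-(n : ℤ))) x) ((f ^ (-(n : ℤ))) y) ≤ U x y := by
  constructor
  · intro h n
    induction n with
    | zero => simp
    | succ n ih =>
      push_cast
      rw [show -((n : ℤ) + 1) = -n - 1 by ring]
      exact (wu_anti hW h n).trans ih
  · intro h
    refine ⟨U x y + 1, by linarith [h0 x y], fun n hn => ?_⟩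
    obtain ⟨m, rfl⟩ : ∃ m : ℕ, n = -m := ⟨n.natAbs, by omega⟩
    linarith [h m]

theorem cont_zpow (hf : Continuous f) (hf' : Continuous f.symm) (n : ℤ) :
    Continuous (f ^ n : Equiv.Perm (ℝ × ℝ)) := by
  have hp : ∀ (g : Equiv.Perm (ℝ × ℝ)), Continuous g → ∀ m : ℕ,
      Continuous (g ^ m : Equiv.Perm (ℝ × ℝ)) := by
    intro g hg m
    induction m with
    | zero => exact continuous_id
    | succ m ih => rw [pow_succ]; exact ih.comp hg
  obtain ⟨m, rfl | rfl⟩ := n.eq_nat_or_neg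
  · rw [zpow_natCast]; exact hp f hf m
  · rw [zpow_neg, zpow_natCast, ← inv_pow]; exact hp f⁻¹ hf' m

end dyn

end LPS

open LPS in
/-- the stable (resp. unstable) set of every point intersects
the unstable (resp. stable) set of the fixed point. -/
theorem every_stable_meets_unstable_of_fixed_point
    (f : Equiv.Perm (ℝ × ℝ)) (hf : Continuous f) (hf' : Continuous f.symm)
    (p : ℝ × ℝ) (hfix : f p = p)
    (U : ℝ × ℝ → ℝ × ℝ → ℝ) (hU : IsLyapunovMetric f U)
    (hBS : BothSigns f U) (hHP : CondHP f U)
    (hNS : NoSingularities f U) (hQI : QuadrantsInvariant f U p) :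
    ∀ q : ℝ × ℝ,
      (Ws f U q ∩ Wu f U p).Nonempty ∧ (Wu f U q ∩ Ws f U p).Nonempty := by
  obtain ⟨hUc, h0, hsy, heq, htri, -, -, hWp⟩ := hU
  have hW : ∀ x y : ℝ × ℝ, 0 ≤ Wd f U x y := by
    intro x y
    rcases eq_or_ne x y with rfl | hne
    · have hz : ∀ z, U z z = 0 := fun z => (heq z z).2 rfl
      simp [Wd, hz]
    · exact (hWp x y hne).le
  let S : ℝ × ℝ → ℝ × ℝ → Prop := fun x y => y ∈ Ws f U x
  let T : ℝ × ℝ → ℝ × ℝ → Prop := fun x y => y ∈ Wu f U x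
  have hz : ∀ z, U z z = 0 := fun z => (heq z z).2 rfl
  have eS : Equivalence S := by
    refine ⟨fun x => ⟨1, one_pos, fun n _ => by rw [hz]; exact zero_le_one⟩, ?_, ?_⟩
    · rintro x y ⟨K, hK, h⟩
      exact ⟨K, hK, fun n hn => by rw [hsy]; exact h n hn⟩
    · rintro x y z ⟨K, hK, h⟩ ⟨K', hK', h'⟩
      exact ⟨K + K', by positivity, fun n hn =>
        (htri _ ((f ^ n) y) _).trans (add_le_add (h n hn) (h' n hn))⟩
  have eT : Equivalence T := by
    refine ⟨fun x => ⟨1, one_pos, fun n _ => by rw [hz]; exact zero_le_one⟩, ?_, ?_⟩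
    · rintro x y ⟨K, hK, h⟩
      exact ⟨K, hK, fun n hn => by rw [hsy]; exact h n hn⟩
    · rintro x y z ⟨K, hK, h⟩ ⟨K', hK', h'⟩
      exact ⟨K + K', by positivity, fun n hn =>
        (htri _ ((f ^ n) y) _).trans (add_le_add (h n hn) (h' n hn))⟩
  have hV1 : ∀ x y, S x y → U (f x) (f y) ≤ U x y := fun x y h => by
    simpa using ws_anti hW h 0
  have hV2 : ∀ x y, S x y → U (f (f x)) (f (f y)) ≤ U (f x) (f y) := fun x y h => by
    have := ws_anti hW h 1
    have e2 : ∀ z, (f ^ ((1 : ℤ) + 1)) z = f (f z) := fun z => by rw [zpow_add]; rfl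
    rw [Nat.cast_one, e2, e2, zpow_one] at this
    exact this
  have hV3 : ∀ x y, T x y → U x y ≤ U (f x) (f y) := fun x y h => by
    have hT : f y ∈ Wu f U (f x) := by
      obtain ⟨K, hK, h⟩ := h
      refine ⟨K + U (f x) (f y), by linarith [h0 (f x) (f y)], fun n hn => ?_⟩
      have e : ∀ z, (f ^ n) (f z) = (f ^ (n + 1)) z := fun z => by
        rw [zpow_add, zpow_one]; rfl
      rcases hn.eq_or_lt with rfl | hn
      · simp [hK.le]
      · rw [e, e]
        linarith [h (n + 1) (by omega), h0 (f x) (f y)]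
    have := wu_anti hW hT 0
    simpa using this
  have H : Sys S T := by
    refine ⟨eS, eT, ?_, ?_⟩
    · intro x y hs ht
      by_contra hne
      have hw := hWp x y hne
      unfold Wd at hw
      linarith [hV1 x y hs, hV2 x y hs, hV3 x y ht]
    · intro r
      obtain ⟨h, k, hk, hc, -, ho, hr, hab⟩ := hNS r
      refine ⟨h, hc, ho, hr, ?_, ?_⟩
      · intro a b b'
        have : h (a, b') ∈ h '' {q : ℝ × ℝ | q.1 = a} := ⟨_, rfl, rfl⟩
        rw [(hab a b).1] at this
        exact ⟨k, hk, fun n hn => connectedComponentIn_subset _ _ this.1 n hn⟩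
      · intro a a' b
        have : h (a', b) ∈ h '' {q : ℝ × ℝ | q.2 = b} := ⟨_, rfl, rfl⟩
        rw [(hab a b).2] at this
        exact ⟨k, hk, fun n hn => connectedComponentIn_subset _ _ this.1 n hn⟩
  have hcU : ∀ n : ℤ, Continuous fun z : (ℝ × ℝ) × (ℝ × ℝ) => U ((f ^ n) z.1) ((f ^ n) z.2) :=
    fun n => hUc.comp (((cont_zpow hf hf' n).comp continuous_fst).prodMk
      ((cont_zpow hf hf' n).comp continuous_snd))
  have cS : IsClosed {z : (ℝ × ℝ) × (ℝ × ℝ) | S z.1 z.2} := by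
    have : {z : (ℝ × ℝ) × (ℝ × ℝ) | S z.1 z.2} =
        ⋂ n : ℕ, {z | U ((f ^ (n : ℤ)) z.1) ((f ^ (n : ℤ)) z.2) ≤ U z.1 z.2} := by
      ext z
      simp only [mem_ofPred_eq, mem_iInter]
      exact ws_iff hW h0 z.1 z.2
    rw [this]
    exact isClosed_iInter fun n => isClosed_le (hcU _) hUc
  have cT : IsClosed {z : (ℝ × ℝ) × (ℝ × ℝ) | T z.1 z.2} := by
    have : {z : (ℝ × ℝ) × (ℝ × ℝ) | T z.1 z.2} =
        ⋂ n : ℕ, {z | U ((f ^ (-(n : ℤ))) z.1) ((f ^ (-(n : ℤ))) z.2) ≤ U z.1 z.2} := by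
      ext z
      simp only [mem_ofPred_eq, mem_iInter]
      exact wu_iff hW h0 z.1 z.2
    rw [this]
    exact isClosed_iInter fun n => isClosed_le (hcU _) hUc
  have bdd : ∀ C : Set (ℝ × ℝ), IsCompact C → ∃ K : Set (ℝ × ℝ), IsCompact K ∧
      ∀ y ∈ C, ∀ z ∈ C, ∀ x, S y x → T z x → x ∈ K := by
    intro C hC
    obtain ⟨R, hR, hh⟩ := hHP C hC 1 one_pos
    refine ⟨C ∪ Metric.closedBall 0 R, hC.union (isCompact_closedBall _ _), ?_⟩
    intro y hy z hz' x hs ht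
    by_contra hn
    simp only [mem_union, Metric.mem_closedBall, dist_zero_right, not_or, not_le] at hn
    have hne : x ≠ y := fun e => hn.1 (e ▸ hy)
    have hq := hh x hn.2 y hy z hz'
    have hw := hWp x y hne
    rw [div_lt_one hw] at hq
    have hs' := eS.symm hs
    have ht' := eT.symm ht
    have a1 := hV1 x y hs'
    have a2 := hV2 x y hs'
    have a3 := hV3 x z ht'
    have a4 := (abs_lt.1 hq).1
    unfold Wd at a4
    unfold Vd at a4
    linarith
  intro q
  obtain ⟨c, h1, h2⟩ := main H cS cT bdd q p
  obtain ⟨d, h3, h4⟩ := main H cS cT bdd p q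
  exact ⟨⟨c, h1.rel, h2.rel⟩, ⟨d, h4.rel, h3.rel⟩⟩
end

section
/- Let f : ℝ² → ℝ² be a homeomorphism with a fixed point p, admitting a Lyapunov metric function U that satisfies the both-signs condition and condition HP; assume f has no singularities and that every connected component of ℝ² \ (Wˢ(p) ∪ Wᵘ(p)) is f-invariant. Then every stable set intersects every unstable set: for all x, y ∈ ℝ², Wˢ(x) ∩ Wᵘ(y) ≠ ∅. -/
/-! ### Abstract part: two transverse equivalence relations -/

open Filter Topology Set

/-- Abstract product structure data for two equivalence relations. -/
structure PS (S T : ℝ × ℝ → ℝ × ℝ → Prop) : Prop where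
  sr : ∀ x, S x x
  tr : ∀ x, T x x
  ss : ∀ {x y}, S x y → S y x
  ts : ∀ {x y}, T x y → T y x
  st : ∀ {x y z}, S x y → S y z → S x z
  tt : ∀ {x y z}, T x y → T y z → T x z
  lim : ∀ (u v w : ℕ → ℝ × ℝ) (x y : ℝ × ℝ), Tendsto u atTop (𝓝 x) → Tendsto v atTop (𝓝 y) →
    (∀ n, S (u n) (w n)) → (∀ n, T (v n) (w n)) →
    ∃ z, S x z ∧ T y z ∧ Tendsto w atTop (𝓝 z)
  uniq : ∀ {x y}, S x y → T x y → x = y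
  loc : ∀ q, ∃ O ∈ 𝓝 q, (∀ a ∈ O, ∀ b ∈ O, ∃ z ∈ O, S a z ∧ T b z) ∧
    (∀ a ∈ O, ∀ b ∈ O, S a b → ∃ J, IsCompact J ∧ IsPreconnected J ∧ a ∈ J ∧ b ∈ J ∧
      ∀ c ∈ J, S a c) ∧
    (∀ a ∈ O, ∀ b ∈ O, T a b → ∃ J, IsCompact J ∧ IsPreconnected J ∧ a ∈ J ∧ b ∈ J ∧
      ∀ c ∈ J, T a c)

theorem PS.swap {S T : ℝ × ℝ → ℝ × ℝ → Prop} (h : PS S T) : PS T S where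
  sr := h.tr
  tr := h.sr
  ss := h.ts
  ts := h.ss
  st := h.tt
  tt := h.st
  lim := by
    intro u v w x y hu hv h1 h2
    obtain ⟨z, a, b, c⟩ := h.lim v u w y x hv hu h2 h1
    exact ⟨z, b, a, c⟩
  uniq := fun a b => h.uniq b a
  loc := by
    intro q
    obtain ⟨O, hO, h1, h2, h3⟩ := h.loc q
    refine ⟨O, hO, ?_, h3, h2⟩
    intro a ha b hb
    obtain ⟨z, hz, k1, k2⟩ := h1 b hb a ha
    exact ⟨z, hz, k2, k1⟩

/-- Limit of brackets is the bracket of the limit. -/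
theorem PS.lim' {S T : ℝ × ℝ → ℝ × ℝ → Prop} (h : PS S T) {u v w : ℕ → ℝ × ℝ} {x y z : ℝ × ℝ}
    (hu : Tendsto u atTop (𝓝 x)) (hv : Tendsto v atTop (𝓝 y))
    (h1 : ∀ n, S (u n) (w n)) (h2 : ∀ n, T (v n) (w n)) (hz1 : S x z) (hz2 : T y z) :
    Tendsto w atTop (𝓝 z) := by
  obtain ⟨z', a, b, c⟩ := h.lim u v w x y hu hv h1 h2
  have : z' = z := h.uniq (h.st (h.ss a) hz1) (h.tt (h.ts b) hz2)
  exact this ▸ c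

theorem PS.rect {S T : ℝ × ℝ → ℝ × ℝ → Prop} (h : PS S T) {x : ℝ × ℝ} {I N : Set (ℝ × ℝ)}
    (hIc : IsCompact I) (hIp : IsPreconnected I) (hxI : x ∈ I) (hIS : ∀ a ∈ I, S x a)
    (hNp : IsPreconnected N) (hxN : x ∈ N) (hNT : ∀ b ∈ N, T x b) :
    ∀ b ∈ N, ∀ a ∈ I, ∃ z, S b z ∧ T a z := by
  have : PreconnectedSpace N := isPreconnected_iff_preconnectedSpace.1 hNp
  have : PreconnectedSpace I := isPreconnected_iff_preconnectedSpace.1 hIp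
  let G : Set N := {b | ∀ a ∈ I, ∃ z, S b z ∧ T a z}
  have hGc : IsClosed G := by
    apply IsSeqClosed.isClosed
    intro b b0 hb hlim a ha
    choose w hw1 hw2 using fun n => hb n a ha
    obtain ⟨z, k1, k2, -⟩ := h.lim (fun n => (b n : ℝ × ℝ)) (fun _ => a) w b0 a
      ((continuous_subtype_val.tendsto b0).comp hlim) tendsto_const_nhds hw1 hw2
    exact ⟨z, k1, k2⟩
  have hGo : IsClosed Gᶜ := by
    apply IsSeqClosed.isClosed
    intro b b0 hb hlim hb0
    have key : ∀ n, ∃ a ∈ I, (∃ z, S (b n) z ∧ T a z) ∧ ∃ a' ∈ I,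
        dist a' a < 1 / ((n : ℝ) + 1) ∧ ¬ ∃ z, S (b n) z ∧ T a' z := by
      intro n
      let F : Set I := {a | ∃ z, S (b n) z ∧ T a z}
      have hFc : IsClosed F := by
        apply IsSeqClosed.isClosed
        intro a a0 ha hal
        choose w hw1 hw2 using ha
        obtain ⟨z, k1, k2, -⟩ := h.lim (fun _ => (b n : ℝ × ℝ)) (fun n => (a n : ℝ × ℝ)) w _ a0
          tendsto_const_nhds ((continuous_subtype_val.tendsto a0).comp hal) hw1 hw2
        exact ⟨z, k1, k2⟩
      have hFn : F.Nonempty := ⟨⟨x, hxI⟩, b n, h.sr _, hNT _ (b n).2⟩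
      have hFo : ¬ IsOpen F := by
        intro ho
        have hu := IsClopen.eq_univ ⟨hFc, ho⟩ hFn
        apply hb n
        intro a ha
        have : (⟨a, ha⟩ : I) ∈ F := hu ▸ mem_univ _
        exact this
      rw [Metric.isOpen_iff] at hFo
      push Not at hFo
      obtain ⟨a, haF, hh⟩ := hFo
      have := hh (1 / ((n : ℝ) + 1)) (by positivity)
      obtain ⟨a', h1, h2⟩ := Set.not_subset.1 this
      exact ⟨a, a.2, haF, a', a'.2, h1, h2⟩
    choose a haI haz a' ha'I hd hnot using key
    choose w hw1 hw2 using haz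
    choose w' hw1' hw2' using fun n => hb0 (a' n) (ha'I n)
    obtain ⟨a0, ha0, φ, hφ, hconv⟩ := hIc.tendsto_subseq haI
    have hbl : Tendsto (fun n => (b (φ n) : ℝ × ℝ)) atTop (𝓝 (b0 : ℝ × ℝ)) :=
      ((continuous_subtype_val.tendsto b0).comp hlim).comp hφ.tendsto_atTop
    have hd0 : Tendsto (fun n => dist (a' (φ n)) (a (φ n))) atTop (𝓝 0) := by
      refine squeeze_zero (fun _ => dist_nonneg) (fun n => (hd (φ n)).le) ?_
      exact tendsto_one_div_add_atTop_nhds_zero_nat.comp hφ.tendsto_atTop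
    have hconv' : Tendsto (fun n => a' (φ n)) atTop (𝓝 a0) := by
      rw [tendsto_iff_dist_tendsto_zero] at hconv ⊢
      have := hd0.add hconv
      rw [add_zero] at this
      exact squeeze_zero (fun _ => dist_nonneg) (fun n => dist_triangle _ _ _) this
    obtain ⟨q, hq1, hq2⟩ := hb0 a0 ha0
    have l1 : Tendsto (fun n => w (φ n)) atTop (𝓝 q) :=
      h.lim' hbl hconv (fun n => hw1 (φ n)) (fun n => hw2 (φ n)) hq1 hq2
    have l2 : Tendsto (fun n => w' (φ n)) atTop (𝓝 q) :=
      h.lim' (tendsto_const_nhds (x := (b0 : ℝ × ℝ))) hconv' (fun n => hw1' (φ n))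
        (fun n => hw2' (φ n)) hq1 hq2
    obtain ⟨O, hO, hO1, -⟩ := h.loc q
    obtain ⟨n, e1, e2⟩ := ((l1.eventually_mem hO).and (l2.eventually_mem hO)).exists
    obtain ⟨z, -, z1, z2⟩ := hO1 _ e1 _ e2
    exact hnot (φ n) ⟨z, h.st (hw1 _) z1, h.tt (hw2' _) z2⟩
  have hu := IsClopen.eq_univ ⟨hGc, isClosed_compl_iff.1 hGo⟩
    ⟨⟨x, hxN⟩, fun a ha => ⟨a, hIS a ha, h.tr a⟩⟩
  intro b hb a ha
  have : (⟨b, hb⟩ : N) ∈ G := hu ▸ mem_univ _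
  exact this a ha

theorem PS.image {S T : ℝ × ℝ → ℝ × ℝ → Prop} (h : PS S T) {b : ℝ × ℝ} {I : Set (ℝ × ℝ)}
    (hIc : IsCompact I) (hIp : IsPreconnected I) (hex : ∀ a ∈ I, ∃ z, S b z ∧ T a z) :
    IsCompact {z | S b z ∧ ∃ a ∈ I, T a z} ∧ IsPreconnected {z | S b z ∧ ∃ a ∈ I, T a z} := by
  choose g hg1 hg2 using fun a : I => hex a a.2
  have hcont : Continuous g := by
    apply SeqContinuous.continuous
    intro a a0 ha
    exact h.lim' (tendsto_const_nhds (x := b)) ((continuous_subtype_val.tendsto a0).comp ha)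
      (fun n => hg1 (a n)) (fun n => hg2 (a n)) (hg1 a0) (hg2 a0)
  have heq : {z | S b z ∧ ∃ a ∈ I, T a z} = range g := by
    ext z
    constructor
    · rintro ⟨h1, a, ha, h2⟩
      exact ⟨⟨a, ha⟩, h.uniq (h.st (h.ss (hg1 _)) h1) (h.tt (h.ts (hg2 ⟨a, ha⟩)) h2)⟩
    · rintro ⟨a, rfl⟩
      exact ⟨hg1 a, a, a.2, hg2 a⟩
  have : PreconnectedSpace I := isPreconnected_iff_preconnectedSpace.1 hIp
  have : CompactSpace I := isCompact_iff_compactSpace.1 hIc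
  rw [heq]
  exact ⟨isCompact_range hcont, isPreconnected_range hcont⟩

/-- Points joined to `x` by a continuum inside the class of `x`. -/
def MM (S : ℝ × ℝ → ℝ × ℝ → Prop) (x : ℝ × ℝ) : Set (ℝ × ℝ) :=
  {a | ∃ I, IsCompact I ∧ IsPreconnected I ∧ x ∈ I ∧ a ∈ I ∧ ∀ c ∈ I, S x c}

theorem PS.half_open {S T : ℝ × ℝ → ℝ × ℝ → Prop} (h : PS S T) {x a b q : ℝ × ℝ}
    (ha : a ∈ MM S x) (hb : b ∈ MM T x) (h1 : S b q) (h2 : T a q) :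
    ∀ᶠ q' in 𝓝 q, ∃ a' ∈ MM S x, T a' q' := by
  obtain ⟨I, hIc, hIp, hxI, haI, hIS⟩ := ha
  obtain ⟨N, -, hNp, hxN, hbN, hNT⟩ := hb
  obtain ⟨O, hO, hO1, hO2, -⟩ := h.loc q
  filter_upwards [hO] with q' hq'
  have hqO : q ∈ O := mem_of_mem_nhds hO
  obtain ⟨z, hzO, z1, z2⟩ := hO1 q hqO q' hq'
  obtain ⟨J, hJc, hJp, hqJ, hzJ, hJS⟩ := hO2 q hqO z hzO z1
  have hr := h.rect hIc hIp hxI hIS hNp hxN hNT b hbN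
  obtain ⟨hKc, hKp⟩ := h.image hIc hIp hr
  set K := {z | S b z ∧ ∃ a ∈ I, T a z} with hK
  have hbK : b ∈ K := ⟨h.sr b, x, hxI, hNT b hbN⟩
  have hqK : q ∈ K := ⟨h1, a, haI, h2⟩
  have hLc : IsCompact (K ∪ J) := hKc.union hJc
  have hLp : IsPreconnected (K ∪ J) := hKp.union q hqK hqJ hJp
  have hLS : ∀ c ∈ K ∪ J, S b c := by
    rintro c (hc | hc)
    · exact hc.1
    · exact h.st h1 (hJS c hc)
  have hr2 := h.rect hLc hLp (Or.inl hbK) hLS hNp hbN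
    (fun c hc => h.tt (h.ts (hNT b hbN)) (hNT c hc)) x hxN
  obtain ⟨hMc, hMp⟩ := h.image hLc hLp hr2
  obtain ⟨w, w1, w2⟩ := hr2 z (Or.inr hzJ)
  refine ⟨w, ⟨_, hMc, hMp, ⟨h.sr x, b, Or.inl hbK, h.ts (hNT b hbN)⟩,
    ⟨w1, z, Or.inr hzJ, w2⟩, fun c hc => hc.1⟩, h.tt (h.ts w2) (h.ts z2)⟩

theorem PS.half_closed {S T : ℝ × ℝ → ℝ × ℝ → Prop} (h : PS S T) {x q : ℝ × ℝ}
    {u : ℕ → ℝ × ℝ} (hu : Tendsto u atTop (𝓝 q)) (hex : ∀ n, ∃ a ∈ MM S x, T a (u n)) :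
    ∃ a ∈ MM S x, T a q := by
  choose a haM haT using hex
  have hS : ∀ n, S x (a n) := fun n => by
    obtain ⟨I, -, -, -, h1, h2⟩ := haM n
    exact h2 _ h1
  obtain ⟨z, z1, z2, hl⟩ := h.lim (fun _ => x) u a x q tendsto_const_nhds hu hS
    (fun n => h.ts (haT n))
  obtain ⟨O, hO, -, hO2, -⟩ := h.loc z
  obtain ⟨n, hn⟩ := (hl.eventually_mem hO).exists
  obtain ⟨J, hJc, hJp, hqJ, hzJ, hJS⟩ := hO2 _ hn z (mem_of_mem_nhds hO)
    (h.st (h.ss (hS n)) z1)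
  obtain ⟨I, hIc, hIp, hxI, haI, hIS⟩ := haM n
  refine ⟨z, ⟨I ∪ J, hIc.union hJc, hIp.union _ haI hqJ hJp, Or.inl hxI, Or.inr hzJ, ?_⟩, h.ts z2⟩
  rintro c (hc | hc)
  · exact hIS c hc
  · exact h.st (hS n) (hJS c hc)

theorem PS.main {S T : ℝ × ℝ → ℝ × ℝ → Prop} (h : PS S T) (x y : ℝ × ℝ) :
    ∃ z, S x z ∧ T y z := by
  let Q : Set (ℝ × ℝ) := {q | (∃ a ∈ MM S y, T a q) ∧ ∃ b ∈ MM T y, S b q}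
  have hQo : IsOpen Q := by
    rw [isOpen_iff_eventually]
    rintro q ⟨⟨a, ha, h2⟩, b, hb, h1⟩
    exact (h.half_open ha hb h1 h2).and (h.swap.half_open hb ha h2 h1)
  have hQc : IsClosed Q := by
    apply IsSeqClosed.isClosed
    intro u q hu hl
    exact ⟨h.half_closed hl fun n => (hu n).1, h.swap.half_closed hl fun n => (hu n).2⟩
  have hu := IsClopen.eq_univ ⟨hQc, hQo⟩
    ⟨y, ⟨y, ⟨{y}, isCompact_singleton, isPreconnected_singleton, rfl, rfl, by
      rintro c rfl; exact h.sr _⟩, h.tr y⟩, y, ⟨{y}, isCompact_singleton,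
      isPreconnected_singleton, rfl, rfl, by rintro c rfl; exact h.tr _⟩, h.sr y⟩
  have hx : x ∈ Q := hu ▸ mem_univ _
  obtain ⟨-, b, ⟨N, -, -, -, hbN, hNT⟩, hb⟩ := hx
  exact ⟨b, h.ss hb, hNT b hbN⟩

/-! ### Concrete part -/

theorem conv_growth (u : ℤ → ℝ) (hu : ∀ n, 0 < u (n + 2) - 2 * u (n + 1) + u n)
    (K : ℝ) (hK : ∀ n, 0 ≤ n → u n ≤ K) (n : ℤ) : u (n + 1) < u n := by
  have main : ∀ n, u (n + 1) ≤ u n := by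
    intro n
    by_contra! hlt
    set d := u (n + 1) - u n with hd
    have hd0 : 0 < d := by linarith
    have hstep : ∀ k : ℕ, d ≤ u (n + k + 1) - u (n + k) := by
      intro k
      induction k with
      | zero => simp [hd]
      | succ k ih =>
        have := hu (n + k)
        have e1 : n + ((k + 1 : ℕ) : ℤ) + 1 = n + k + 2 := by push_cast; ring
        have e2 : n + ((k + 1 : ℕ) : ℤ) = n + k + 1 := by push_cast; ring
        rw [e1, e2]
        linarith
    have hlin : ∀ k : ℕ, u n + k * d ≤ u (n + k) := by
      intro k
      induction k with
      | zero => simp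
      | succ k ih =>
        have := hstep k
        have e2 : n + ((k + 1 : ℕ) : ℤ) = n + k + 1 := by push_cast; ring
        rw [e2]
        push_cast
        linarith
    obtain ⟨m, hm⟩ := exists_nat_gt ((K - u n) / d)
    rw [div_lt_iff₀ hd0] at hm
    have h1 := hlin (m + n.natAbs)
    have h2 := hK (n + ((m + n.natAbs : ℕ) : ℤ)) (by omega)
    push_cast at h1 h2
    have h3 : (0 : ℝ) ≤ (n.natAbs : ℝ) * d := by positivity
    push_cast at h3
    nlinarith
  have h1 := main (n + 1)
  have h2 := hu n
  have e : n + 1 + 1 = n + 2 := by ring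
  rw [e] at h1
  linarith

theorem conv_growth_neg (u : ℤ → ℝ) (hu : ∀ n, 0 < u (n + 2) - 2 * u (n + 1) + u n)
    (K : ℝ) (hK : ∀ n, n ≤ 0 → u n ≤ K) (n : ℤ) : u n < u (n + 1) := by
  have := conv_growth (fun m => u (-m)) (fun m => by
    have := hu (-m - 2)
    have e1 : -m - 2 + 2 = -m := by ring
    have e2 : -m - 2 + 1 = -(m + 1) := by ring
    have e3 : -m - 2 = -(m + 2) := by ring
    rw [e1, e2, e3] at this
    linarith) K (fun m hm => hK _ (by omega)) (-n - 1)
  simp only [neg_sub, neg_add_rev] at this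
  convert this using 2 <;> ring

section Concrete

variable {f : Equiv.Perm (ℝ × ℝ)} {U : ℝ × ℝ → ℝ × ℝ → ℝ}

theorem conv_seq (hU : IsLyapunovMetric f U) {x y : ℝ × ℝ} (hxy : x ≠ y) (n : ℤ) :
    0 < U ((f ^ (n + 2)) x) ((f ^ (n + 2)) y) - 2 * U ((f ^ (n + 1)) x) ((f ^ (n + 1)) y)
      + U ((f ^ n) x) ((f ^ n) y) := by
  obtain ⟨-, -, -, -, -, -, -, hW⟩ := hU
  have := hW ((f ^ n) x) ((f ^ n) y) (by simpa using hxy)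
  have e1 : f ^ (n + 1) = f * f ^ n := by rw [add_comm, zpow_add, zpow_one]
  have e2 : f ^ (n + 2) = f * (f * f ^ n) := by
    rw [← e1, ← zpow_one_add]; congr 1; ring
  rw [e1, e2]
  exact this

theorem ws_dec (hU : IsLyapunovMetric f U) {x y : ℝ × ℝ} (hxy : x ≠ y) (h : y ∈ Ws f U x) (n : ℤ) :
    U ((f ^ (n + 1)) x) ((f ^ (n + 1)) y) < U ((f ^ n) x) ((f ^ n) y) := by
  obtain ⟨K, -, hK⟩ := h
  exact conv_growth (fun n => U ((f ^ n) x) ((f ^ n) y)) (conv_seq hU hxy) K hK n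

theorem wu_inc (hU : IsLyapunovMetric f U) {x y : ℝ × ℝ} (hxy : x ≠ y) (h : y ∈ Wu f U x) (n : ℤ) :
    U ((f ^ n) x) ((f ^ n) y) < U ((f ^ (n + 1)) x) ((f ^ (n + 1)) y) := by
  obtain ⟨K, -, hK⟩ := h
  exact conv_growth_neg (fun n => U ((f ^ n) x) ((f ^ n) y)) (conv_seq hU hxy) K hK n

theorem ws_le (hU : IsLyapunovMetric f U) {x y : ℝ × ℝ} (h : y ∈ Ws f U x) (n : ℤ) (hn : 0 ≤ n) :
    U ((f ^ n) x) ((f ^ n) y) ≤ U x y := by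
  by_cases hxy : x = y
  · subst hxy
    rw [(hU.2.2.2.1 _ _).2 rfl, (hU.2.2.2.1 _ _).2 rfl]
  · induction n, hn using Int.le_induction with
    | base => simp
    | succ n hn ih => exact (ws_dec hU hxy h n).le.trans ih

theorem wu_le (hU : IsLyapunovMetric f U) {x y : ℝ × ℝ} (h : y ∈ Wu f U x) (n : ℤ) (hn : n ≤ 0) :
    U ((f ^ n) x) ((f ^ n) y) ≤ U x y := by
  by_cases hxy : x = y
  · subst hxy
    rw [(hU.2.2.2.1 _ _).2 rfl, (hU.2.2.2.1 _ _).2 rfl]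
  · induction n, hn using Int.le_induction_down with
    | base => simp
    | pred n hn ih =>
      have := wu_inc hU hxy h (n - 1)
      rw [sub_add_cancel] at this
      exact this.le.trans ih

theorem cont_zpow (hf : Continuous f) (hf' : Continuous f.symm) (n : ℤ) :
    Continuous (f ^ n : Equiv.Perm (ℝ × ℝ)) := by
  induction n using Int.induction_on with
  | zero => exact continuous_id
  | succ n ih =>
    rw [zpow_add_one]
    exact ih.comp hf
  | pred n ih =>
    rw [zpow_sub_one]
    exact ih.comp hf'

theorem key_bound (hU : IsLyapunovMetric f U) (hHP : CondHP f U) (C : Set (ℝ × ℝ))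
    (hC : IsCompact C) :
    ∃ R : ℝ, ∀ x ∈ C, ∀ y ∈ C, ∀ z, z ∈ Ws f U x → z ∈ Wu f U y → ‖z‖ ≤ R := by
  obtain ⟨R, -, hR⟩ := hHP C hC 1 one_pos
  obtain ⟨R', hR'⟩ := hC.isBounded.exists_norm_le
  refine ⟨max R R', fun x hx y hy z hzx hzy => ?_⟩
  by_contra! hlt
  have h1 : R < ‖z‖ := (le_max_left _ _).trans_lt hlt
  have h2 : R' < ‖z‖ := (le_max_right _ _).trans_lt hlt
  have hxz : x ≠ z := by rintro rfl; exact absurd (hR' _ hx) (not_le.2 h2)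
  have hyz : y ≠ z := by rintro rfl; exact absurd (hR' _ hy) (not_le.2 h2)
  have hq := hR z h1 x hx y hy
  have hW : 0 < Wd f U z x := hU.2.2.2.2.2.2.2 z x hxz.symm
  rw [div_lt_one hW] at hq
  have d1 := ws_dec hU hxz hzx 1
  have d2 := wu_inc hU hyz hzy 0
  have e : f ^ ((1 : ℤ) + 1) = f * f := by
    rw [zpow_add, zpow_one]
  rw [e] at d1
  simp only [zpow_one, Equiv.Perm.mul_apply, zero_add, zpow_zero, Equiv.Perm.one_apply] at d1 d2
  have hs := hU.2.2.1
  rw [hs (f (f x)), hs (f x)] at d1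
  rw [hs y z, hs (f y)] at d2
  have := (abs_lt.1 hq).1
  unfold Vd Wd at this
  linarith

theorem concretePS (hf : Continuous f) (hf' : Continuous f.symm)
    (hU : IsLyapunovMetric f U) (hHP : CondHP f U) (hNS : NoSingularities f U) :
    PS (fun x y => y ∈ Ws f U x) (fun x y => y ∈ Wu f U x) := by
  have hcU := hU.1
  have hsym := hU.2.2.1
  have hz := hU.2.2.2.1
  have htri := hU.2.2.2.2.1
  have sr : ∀ x, x ∈ Ws f U x := fun x => ⟨1, one_pos, fun n _ => by
    rw [(hz _ _).2 rfl]; exact zero_le_one⟩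
  have tr : ∀ x, x ∈ Wu f U x := fun x => ⟨1, one_pos, fun n _ => by
    rw [(hz _ _).2 rfl]; exact zero_le_one⟩
  have ss : ∀ {x y}, y ∈ Ws f U x → x ∈ Ws f U y := by
    rintro x y ⟨K, h0, hK⟩
    exact ⟨K, h0, fun n hn => by rw [hsym]; exact hK n hn⟩
  have ts : ∀ {x y}, y ∈ Wu f U x → x ∈ Wu f U y := by
    rintro x y ⟨K, h0, hK⟩
    exact ⟨K, h0, fun n hn => by rw [hsym]; exact hK n hn⟩
  have st : ∀ {x y z}, y ∈ Ws f U x → z ∈ Ws f U y → z ∈ Ws f U x := by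
    rintro x y z ⟨K, h0, hK⟩ ⟨K', h0', hK'⟩
    exact ⟨K + K', by linarith, fun n hn =>
      (htri _ ((f ^ n) y) _).trans (add_le_add (hK n hn) (hK' n hn))⟩
  have tt : ∀ {x y z}, y ∈ Wu f U x → z ∈ Wu f U y → z ∈ Wu f U x := by
    rintro x y z ⟨K, h0, hK⟩ ⟨K', h0', hK'⟩
    exact ⟨K + K', by linarith, fun n hn =>
      (htri _ ((f ^ n) y) _).trans (add_le_add (hK n hn) (hK' n hn))⟩
  have uniq : ∀ {x y}, y ∈ Ws f U x → y ∈ Wu f U x → x = y := by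
    intro x y h1 h2
    by_contra hne
    exact lt_asymm (ws_dec hU hne h1 0) (wu_inc hU hne h2 0)
  have tU : ∀ {u w : ℕ → ℝ × ℝ} {x z : ℝ × ℝ} (n : ℤ), Tendsto u atTop (𝓝 x) →
      Tendsto w atTop (𝓝 z) → Tendsto (fun m => U ((f ^ n) (u m)) ((f ^ n) (w m))) atTop
        (𝓝 (U ((f ^ n) x) ((f ^ n) z))) := by
    intro u w x z n hu hw
    have c := (cont_zpow hf hf' n)
    exact (hcU.tendsto ((f ^ n) x, (f ^ n) z)).comp
      (((c.tendsto x).comp hu).prodMk_nhds ((c.tendsto z).comp hw))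
  have tU0 : ∀ {u w : ℕ → ℝ × ℝ} {x z : ℝ × ℝ}, Tendsto u atTop (𝓝 x) →
      Tendsto w atTop (𝓝 z) → Tendsto (fun m => U (u m) (w m)) atTop (𝓝 (U x z)) :=
    fun hu hw => tU 0 hu hw
  have clS : ∀ {u w : ℕ → ℝ × ℝ} {x z : ℝ × ℝ}, Tendsto u atTop (𝓝 x) →
      Tendsto w atTop (𝓝 z) → (∀ n, w n ∈ Ws f U (u n)) → z ∈ Ws f U x := by
    intro u w x z hu hw h
    refine ⟨U x z + 1, by have := hU.2.1 x z; linarith, fun n hn => ?_⟩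
    have := le_of_tendsto_of_tendsto' (tU n hu hw) (tU0 hu hw) (fun m => ws_le hU (h m) n hn)
    linarith
  have clT : ∀ {u w : ℕ → ℝ × ℝ} {x z : ℝ × ℝ}, Tendsto u atTop (𝓝 x) →
      Tendsto w atTop (𝓝 z) → (∀ n, w n ∈ Wu f U (u n)) → z ∈ Wu f U x := by
    intro u w x z hu hw h
    refine ⟨U x z + 1, by have := hU.2.1 x z; linarith, fun n hn => ?_⟩
    have := le_of_tendsto_of_tendsto' (tU n hu hw) (tU0 hu hw) (fun m => wu_le hU (h m) n hn)
    linarith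
  refine ⟨sr, tr, ss, ts, st, tt, ?_, uniq, ?_⟩
  · intro u v w x y hu hv h1 h2
    obtain ⟨R, hR⟩ := key_bound hU hHP (insert x (range u) ∪ insert y (range v))
      (hu.isCompact_insert_range.union hv.isCompact_insert_range)
    have hw : ∀ n, w n ∈ Metric.closedBall (0 : ℝ × ℝ) R := fun n => by
      rw [mem_closedBall_zero_iff]
      exact hR (u n) (Or.inl (Or.inr ⟨n, rfl⟩)) (v n) (Or.inr (Or.inr ⟨n, rfl⟩)) _ (h1 n) (h2 n)
    have hcpt := isCompact_closedBall (0 : ℝ × ℝ) R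
    obtain ⟨z, -, φ, hφ, hl⟩ := hcpt.tendsto_subseq hw
    have zS : z ∈ Ws f U x := clS (hu.comp hφ.tendsto_atTop) hl (fun n => h1 _)
    have zT : z ∈ Wu f U y := clT (hv.comp hφ.tendsto_atTop) hl (fun n => h2 _)
    refine ⟨z, zS, zT, ?_⟩
    apply tendsto_of_subseq_tendsto
    intro ns hns
    obtain ⟨z', -, ψ, hψ, hl'⟩ := hcpt.tendsto_subseq (fun n => hw (ns n))
    have hm := hns.comp hψ.tendsto_atTop
    have zS' : z' ∈ Ws f U x := clS (hu.comp hm) hl' (fun n => h1 _)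
    have zT' : z' ∈ Wu f U y := clT (hv.comp hm) hl' (fun n => h2 _)
    have : z' = z := uniq (st (ss zS') zS) (tt (ts zT') zT)
    exact ⟨ψ, this ▸ hl'⟩
  · intro q
    obtain ⟨h, k, hk, hc, hinj, hopen, hq, hab⟩ := hNS q
    have pS : ∀ a b b', h (a, b') ∈ Ws f U (h (a, b)) := by
      intro a b b'
      have : h (a, b') ∈ h '' {q : ℝ × ℝ | q.1 = a} := ⟨_, rfl, rfl⟩
      rw [(hab a b).1] at this
      exact ⟨k, hk, connectedComponentIn_subset _ _ this.1⟩
    have pT : ∀ a b a', h (a', b) ∈ Wu f U (h (a, b)) := by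
      intro a b a'
      have : h (a', b) ∈ h '' {q : ℝ × ℝ | q.2 = b} := ⟨_, rfl, rfl⟩
      rw [(hab a b).2] at this
      exact ⟨k, hk, connectedComponentIn_subset _ _ this.1⟩
    refine ⟨range h, hopen.isOpen_range.mem_nhds hq, ?_, ?_, ?_⟩
    · rintro _ ⟨⟨a, b⟩, rfl⟩ _ ⟨⟨a', b'⟩, rfl⟩
      exact ⟨h (a, b'), ⟨_, rfl⟩, pS _ _ _, pT _ _ _⟩
    · rintro _ ⟨⟨a, b⟩, rfl⟩ _ ⟨⟨a', b'⟩, rfl⟩ hs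
      have e : h (a, b') = h (a', b') := uniq (st (pS a b' b) hs) (pT _ _ _)
      have e' : a = a' := (Prod.ext_iff.1 (hinj e)).1
      subst e'
      have hcc : Continuous (fun t : ℝ => h (a, t)) := by fun_prop
      refine ⟨(fun t : ℝ => h (a, t)) '' uIcc b b', isCompact_uIcc.image hcc,
        isPreconnected_uIcc.image _ hcc.continuousOn, ⟨b, left_mem_uIcc, rfl⟩,
        ⟨b', right_mem_uIcc, rfl⟩, ?_⟩
      rintro _ ⟨t, -, rfl⟩
      exact pS _ _ _
    · rintro _ ⟨⟨a, b⟩, rfl⟩ _ ⟨⟨a', b'⟩, rfl⟩ hs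
      have e : h (a', b) = h (a', b') := uniq (pS _ _ _) (tt (pT a' b a) hs)
      have e' : b = b' := (Prod.ext_iff.1 (hinj e)).2
      subst e'
      have hcc : Continuous (fun t : ℝ => h (t, b)) := by fun_prop
      refine ⟨(fun t : ℝ => h (t, b)) '' uIcc a a', isCompact_uIcc.image hcc,
        isPreconnected_uIcc.image _ hcc.continuousOn, ⟨a, left_mem_uIcc, rfl⟩,
        ⟨a', right_mem_uIcc, rfl⟩, ?_⟩
      rintro _ ⟨t, -, rfl⟩
      exact pT _ _ _

end Concrete

/-- every stable set intersects every unstable set. -/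
theorem every_stable_meets_every_unstable
    (f : Equiv.Perm (ℝ × ℝ)) (hf : Continuous f) (hf' : Continuous f.symm)
    (p : ℝ × ℝ) (hfix : f p = p)
    (U : ℝ × ℝ → ℝ × ℝ → ℝ) (hU : IsLyapunovMetric f U)
    (hBS : BothSigns f U) (hHP : CondHP f U)
    (hNS : NoSingularities f U) (hQI : QuadrantsInvariant f U p) :
    ∀ x y : ℝ × ℝ, (Ws f U x ∩ Wu f U y).Nonempty := by
  intro x y
  obtain ⟨z, h1, h2⟩ := (concretePS hf hf' hU hHP hNS).main x y
  exact ⟨z, h1, h2⟩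
end
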